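/- arXiv:1501.06214 — 7 statements merged into one kernel-verified Lean document; each statement's English description precedes it below -/
import Mathlib

section
/- Let n ≥ 1 and R > 0. There exists a constant C > 0, depending only on n and R, such that for all convex bodies K, L in ℝⁿ with K + 2Bⁿ and L + 2Bⁿ contained in a closed ball of radius R, and for every i ∈ {0, 1, …, n−1}, the bounded Lipschitz distance of the i-th support measures satisfies d_bL(Λ_i(K,·), Λ_i(L,·)) ≤ C · d_H(K, L)^{1/2}. -/
open MeasureTheory Metric Set Real Pointwise RealInnerProductSpace

noncomputable section

/-- Euclidean n-space. -/
abbrev En (n : ℕ) : Type := EuclideanSpace ℝ (Fin n)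

/-- A convex body: a nonempty compact convex set. -/
def IsConvexBody {n : ℕ} (K : Set (En n)) : Prop :=
  K.Nonempty ∧ IsCompact K ∧ Convex ℝ K

/-- The parallel body `K_ρ = K + ρ Bⁿ`. -/
def pbody {n : ℕ} (K : Set (En n)) (ρ : ℝ) : Set (En n) :=
  K + Metric.closedBall (0 : En n) ρ

/-- `K^ρ = K_ρ \ K`. -/
def shell {n : ℕ} (K : Set (En n)) (ρ : ℝ) : Set (En n) :=
  pbody K ρ \ K

/-- `p` is the metric projection onto `K`. -/
def IsMetricProj {n : ℕ} (K : Set (En n)) (p : En n → En n) : Prop :=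
  ∀ x, p x ∈ K ∧ dist x (p x) = Metric.infDist x K

/-- `u_K(x) = (x - p_K(x)) / dist(x, K)`. -/
def uvec {n : ℕ} (K : Set (En n)) (p : En n → En n) (x : En n) : En n :=
  (Metric.infDist x K)⁻¹ • (x - p x)

/-- The local parallel volume measure `μ_{K,ρ}`. -/
def parMeas {n : ℕ} (K : Set (En n)) (p : En n → En n) (ρ : ℝ) :
    Measure (En n × En n) :=
  Measure.map (fun x => (p x, uvec K p x)) (volume.restrict (shell K ρ))

/-- A test function for the bounded Lipschitz distance on `ℝⁿ × ℝⁿ`: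
Lipschitz constant at most 1 w.r.t. the Euclidean metric on the product, and `sup |f| ≤ 1`. -/
def IsBLFun {n : ℕ} (f : En n × En n → ℝ) : Prop :=
  (∀ a b : En n × En n, |f a - f b| ≤ Real.sqrt (‖a.1 - b.1‖ ^ 2 + ‖a.2 - b.2‖ ^ 2)) ∧
  ∀ a, |f a| ≤ 1

/-- `κ_m`, the volume of the `m`-dimensional unit ball. -/
def kappa (m : ℕ) : ℝ :=
  (volume (Metric.closedBall (0 : EuclideanSpace ℝ (Fin m)) 1)).toReal

/-- The matrix of the linear system from the local Steiner formula at `ρ_j = j/n`. -/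
def steinerMatrix (n : ℕ) : Matrix (Fin n) (Fin n) ℝ :=
  Matrix.of fun j i => ((j.1 + 1 : ℝ) / n) ^ (n - i.1) * kappa (n - i.1)

/-- The coefficients `a_{ij}` expressing the support measures via local parallel volumes. -/
def steinerCoeff (n : ℕ) : Matrix (Fin n) (Fin n) ℝ := (steinerMatrix n)⁻¹

/-- A test function for the bounded Lipschitz distance on the sphere `S^{n-1}`. -/
def IsSphereBLFun {n : ℕ} (g : En n → ℝ) : Prop :=
  (∀ a b : En n, ‖a‖ = 1 → ‖b‖ = 1 → |g a - g b| ≤ ‖a - b‖) ∧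
  ∀ a : En n, ‖a‖ = 1 → |g a| ≤ 1


theorem hsm_proj_inner {n : ℕ} {K : Set (En n)} (hK : IsConvexBody K) {p : En n → En n}
    (hp : IsMetricProj K p) (x w : En n) (hw : w ∈ K) : ⟪x - p x, w - p x⟫ ≤ 0 := by
  have h := (norm_eq_iInf_iff_real_inner_le_zero hK.2.2 (u := x) (hp x).1).1
  refine h ?_ w hw
  rw [← dist_eq_norm, (hp x).2, Metric.infDist_eq_iInf]
  simp [dist_eq_norm]

theorem hsm_proj_norm {n : ℕ} {K : Set (En n)} {p : En n → En n}
    (hp : IsMetricProj K p) (x : En n) : ‖x - p x‖ = infDist x K := by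
  rw [← dist_eq_norm, (hp x).2]

theorem hsm_proj_unique {n : ℕ} {K : Set (En n)} (hK : IsConvexBody K) {p : En n → En n}
    (hp : IsMetricProj K p) (x q : En n) (hq : q ∈ K)
    (h : ∀ w ∈ K, ⟪x - q, w - q⟫ ≤ 0) : p x = q := by
  have h1 := hsm_proj_inner hK hp x q hq
  have h2 := h (p x) (hp x).1
  have h3 : ⟪q - p x, q - p x⟫ = ⟪x - p x, q - p x⟫ + ⟪x - q, p x - q⟫ := by
    have e1 : q - p x = (x - p x) - (x - q) := by abel
    have e2 : p x - q = -(q - p x) := by abel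
    rw [e2, inner_neg_right, ← sub_eq_add_neg, ← inner_sub_left, ← e1]
  rw [real_inner_self_eq_norm_sq] at h3
  have h4 : ‖q - p x‖ = 0 := by nlinarith [norm_nonneg (q - p x)]
  exact (sub_eq_zero.1 (norm_eq_zero.1 h4)).symm

theorem hsm_proj_lip {n : ℕ} {K : Set (En n)} (hK : IsConvexBody K) {p : En n → En n}
    (hp : IsMetricProj K p) : LipschitzWith 1 p := by
  refine LipschitzWith.of_dist_le_mul fun x y => ?_
  have h1 := hsm_proj_inner hK hp x (p y) (hp y).1
  have h2 := hsm_proj_inner hK hp y (p x) (hp x).1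
  have h3 : ⟪p x - p y, p x - p y⟫ =
      ⟪x - y, p x - p y⟫ + ⟪x - p x, p y - p x⟫ + ⟪y - p y, p x - p y⟫ := by
    simp only [inner_sub_left, inner_sub_right]; ring
  rw [real_inner_self_eq_norm_sq] at h3
  have h4 := real_inner_le_norm (x - y) (p x - p y)
  simp only [dist_eq_norm, NNReal.coe_one, one_mul]
  by_contra! h
  nlinarith [norm_nonneg (x - y), norm_nonneg (p x - p y)]

theorem hsm_u_norm {n : ℕ} {K : Set (En n)} {p : En n → En n}
    (hp : IsMetricProj K p) (x : En n) (hx : 0 < infDist x K) : ‖uvec K p x‖ = 1 := by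
  rw [uvec, norm_smul, hsm_proj_norm hp, norm_inv, Real.norm_of_nonneg hx.le]
  exact inv_mul_cancel₀ hx.ne'

theorem hsm_u_smul {n : ℕ} {K : Set (En n)} {p : En n → En n}
    (x : En n) (hx : 0 < infDist x K) : infDist x K • uvec K p x = x - p x := by
  rw [uvec, smul_smul, mul_inv_cancel₀ hx.ne', one_smul]

theorem hsm_u_inner {n : ℕ} {K : Set (En n)} (hK : IsConvexBody K) {p : En n → En n}
    (hp : IsMetricProj K p) (x w : En n) (hw : w ∈ K) : ⟪uvec K p x, w - p x⟫ ≤ 0 := by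
  rw [uvec, real_inner_smul_left]
  exact mul_nonpos_of_nonneg_of_nonpos (inv_nonneg.2 infDist_nonneg) (hsm_proj_inner hK hp x w hw)

/-- The shift `x ↦ x + c u(x)`. -/
theorem hsm_shift_dist {n : ℕ} {K : Set (En n)} (hK : IsConvexBody K) {p : En n → En n}
    (hp : IsMetricProj K p) (x : En n) (hx : 0 < infDist x K) (c : ℝ) (hc : 0 ≤ c) :
    infDist (x + c • uvec K p x) K = infDist x K + c := by
  have e : x + c • uvec K p x - p x = (infDist x K + c) • uvec K p x := by
    rw [add_smul, hsm_u_smul x hx]; abel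
  have h : p (x + c • uvec K p x) = p x := by
    refine hsm_proj_unique hK hp _ _ (hp x).1 fun w hw => ?_
    rw [e, real_inner_smul_left]
    exact mul_nonpos_of_nonneg_of_nonpos (by linarith) (hsm_u_inner hK hp x w hw)
  rw [← hsm_proj_norm hp, h, e, norm_smul, hsm_u_norm hp x hx, mul_one,
    Real.norm_of_nonneg (by linarith)]

theorem hsm_shift_expand {n : ℕ} {K : Set (En n)} (hK : IsConvexBody K) {p : En n → En n}
    (hp : IsMetricProj K p) (x y : En n) (hx : 0 < infDist x K) (hy : 0 < infDist y K)
    (c : ℝ) (hc : 0 ≤ c) :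
    dist x y ≤ dist (x + c • uvec K p x) (y + c • uvec K p y) := by
  set u := uvec K p x with hu
  set v := uvec K p y with hv
  have h1 := hsm_u_inner hK hp x (p y) (hp y).1
  have h2 := hsm_u_inner hK hp y (p x) (hp x).1
  rw [← hu] at h1
  rw [← hv] at h2
  have ex : x = p x + infDist x K • u := by rw [hu, hsm_u_smul x hx]; abel
  have ey : y = p y + infDist y K • v := by rw [hv, hsm_u_smul y hy]; abel
  have nu : ⟪u, u⟫ = 1 := by rw [real_inner_self_eq_norm_sq, hu, hsm_u_norm hp x hx]; norm_num
  have nv : ⟪v, v⟫ = 1 := by rw [real_inner_self_eq_norm_sq, hv, hsm_u_norm hp y hy]; norm_num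
  have huv : ⟪u, v⟫ ≤ 1 := by
    have := real_inner_le_norm u v
    rwa [hu, hv, hsm_u_norm hp x hx, hsm_u_norm hp y hy, one_mul] at this
  have key : 0 ≤ ⟪x - y, u - v⟫ := by
    have e : x - y = (p x - p y) + (infDist x K • u - infDist y K • v) := by
      nth_rw 1 [ex]; nth_rw 1 [ey]; abel
    rw [e, inner_add_left]
    have a1 : ⟪p x - p y, u - v⟫ = -⟪u, p y - p x⟫ - ⟪v, p x - p y⟫ := by
      simp only [inner_sub_left, inner_sub_right, real_inner_comm]; ring
    have a2 : ⟪infDist x K • u - infDist y K • v, u - v⟫ =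
        (infDist x K + infDist y K) * (1 - ⟪u, v⟫) := by
      simp only [inner_sub_left, inner_sub_right, real_inner_smul_left, nu, nv,
        real_inner_comm u v]; ring
    rw [a1, a2]
    have := mul_nonneg (add_pos hx hy).le (sub_nonneg.2 huv)
    linarith
  have e : x + c • u - (y + c • v) = (x - y) + c • (u - v) := by rw [smul_sub]; abel
  rw [dist_eq_norm, dist_eq_norm, e]
  refine (sq_le_sq₀ (norm_nonneg _) (norm_nonneg _)).1 ?_
  rw [norm_add_sq_real, real_inner_smul_right]
  have := mul_nonneg hc key
  nlinarith [sq_nonneg ‖c • (u - v)‖]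

theorem hsm_vol_expand {n : ℕ} (A : Set (En n)) (S : En n → En n)
    (h : ∀ x ∈ A, ∀ y ∈ A, dist x y ≤ dist (S x) (S y)) : volume A ≤ volume (S '' A) := by
  have hinj : InjOn S A := fun x hx y hy hxy => by
    have := h x hx y hy
    rw [hxy, dist_self] at this
    exact dist_le_zero.1 this
  have hl : LipschitzOnWith 1 (Function.invFunOn S A) (S '' A) := by
    refine LipschitzOnWith.of_dist_le_mul ?_
    rintro _ ⟨x, hx, rfl⟩ _ ⟨y, hy, rfl⟩
    rw [hinj.leftInvOn_invFunOn hx, hinj.leftInvOn_invFunOn hy]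
    simpa using h x hx y hy
  have := hl.hausdorffMeasure_image_le (d := (Module.finrank ℝ (En n) : ℝ)) (by positivity)
  rw [hinj.invFunOn_image Subset.rfl] at this
  simp only [ENNReal.coe_one, ENNReal.one_rpow, one_mul] at this
  rw [Measure.isAddLeftInvariant_eq_smul (volume : Measure (En n)) (μH[Module.finrank ℝ (En n)])]
  simp only [Measure.smul_apply]
  gcongr

theorem hsm_mem_pbody {n : ℕ} {K : Set (En n)} (hK : IsConvexBody K) {ρ : ℝ} (hρ : 0 ≤ ρ)
    (x : En n) : x ∈ pbody K ρ ↔ infDist x K ≤ ρ := by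
  rw [pbody, hK.2.1.add_closedBall_zero hρ, mem_cthickening_iff, infDist,
    ENNReal.le_ofReal_iff_toReal_le (infEDist_ne_top hK.1) hρ]

theorem hsm_shell {n : ℕ} {K : Set (En n)} (hK : IsConvexBody K) {ρ : ℝ} (hρ : 0 ≤ ρ) :
    shell K ρ = {x | 0 < infDist x K ∧ infDist x K ≤ ρ} := by
  ext x
  rw [shell, mem_sdiff, hsm_mem_pbody hK hρ, mem_ofPred_eq, and_comm,
    hK.2.1.isClosed.mem_iff_infDist_zero hK.1, infDist_nonneg.lt_iff_ne', ne_eq]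

/-- Points with distance in `(t, s]`. -/
def hsmLayer {n : ℕ} (K : Set (En n)) (t s : ℝ) : Set (En n) :=
  {x | t < infDist x K ∧ infDist x K ≤ s}

theorem hsm_layer_meas {n : ℕ} (K : Set (En n)) (t s : ℝ) : MeasurableSet (hsmLayer K t s) := by
  have h : Measurable fun x : En n => infDist x K := (continuous_infDist_pt K).measurable
  exact (measurableSet_lt measurable_const h).inter (measurableSet_le h measurable_const)

theorem hsm_layer_vol {n : ℕ} {K : Set (En n)} (hK : IsConvexBody K) {p : En n → En n}
    (hp : IsMetricProj K p) {z : En n} {R : ℝ} (hz : pbody K 2 ⊆ closedBall z R)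
    {t δ : ℝ} (ht : 0 ≤ t) (ht1 : t ≤ 1) (hδ : 0 ≤ δ) (hδ1 : δ ≤ 1) :
    volume (hsmLayer K t (t + δ)) ≤ ENNReal.ofReal (2 * δ) * volume (closedBall (0 : En n) R) := by
  rcases hδ.eq_or_lt with rfl | hδ0
  · have : hsmLayer K t (t + 0) = ∅ := by
      ext x; simp [hsmLayer]
    rw [this]; simp
  set N := ⌊1 / δ⌋₊ with hN
  have hN1 : (N : ℝ) * δ ≤ 1 := by
    have := Nat.floor_le (a := 1 / δ) (by positivity)
    rwa [le_div_iff₀ hδ0] at this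
  have hN2 : 1 ≤ 2 * δ * N := by
    have h1 : 1 / δ < N + 1 := Nat.lt_floor_add_one _
    rw [div_lt_iff₀ hδ0] at h1
    have h2 : (1 : ℝ) ≤ N := by
      exact_mod_cast (Nat.one_le_floor_iff _).2 ((one_le_div hδ0).2 hδ1)
    nlinarith
  let A : ℕ → Set (En n) := fun k => hsmLayer K (t + k * δ) (t + k * δ + δ)
  have h1 : ∀ k : ℕ, volume (hsmLayer K t (t + δ)) ≤ volume (A k) := by
    intro k
    have hk : 0 ≤ (k : ℝ) * δ := by positivity
    refine (hsm_vol_expand _ (fun x => x + ((k : ℝ) * δ) • uvec K p x) ?_).trans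
      (measure_mono ?_)
    · intro x hx y hy
      exact hsm_shift_expand hK hp x y (ht.trans_lt hx.1) (ht.trans_lt hy.1) _ hk
    · rintro _ ⟨x, hx, rfl⟩
      have := hsm_shift_dist hK hp x (ht.trans_lt hx.1) _ hk
      exact ⟨by rw [this]; linarith [hx.1], by rw [this]; linarith [hx.2]⟩
  have h2 : ∑ k ∈ Finset.range N, volume (A k) ≤ volume (closedBall z R) := by
    rw [← measure_biUnion_finset]
    · refine measure_mono (iUnion₂_subset fun k hk x hx => hz ?_)
      rw [hsm_mem_pbody hK (by norm_num)]
      have hk' : (k : ℝ) + 1 ≤ N := by exact_mod_cast Finset.mem_range.1 hk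
      have := hx.2
      nlinarith
    · intro i _ j _ hij
      rw [Function.onFun, Set.disjoint_left]
      intro x hx hx'
      have a1 := hx.1
      have a2 := hx.2
      have a3 := hx'.1
      have a4 := hx'.2
      rcases lt_or_gt_of_ne hij with h | h
      · have : (i : ℝ) + 1 ≤ j := by exact_mod_cast h
        nlinarith
      · have : (j : ℝ) + 1 ≤ i := by exact_mod_cast h
        nlinarith
    · exact fun k _ => hsm_layer_meas _ _ _
  have h3 : (N : ENNReal) * volume (hsmLayer K t (t + δ)) ≤ volume (closedBall z R) := by
    refine le_trans ?_ h2
    have := Finset.card_nsmul_le_sum (Finset.range N) (fun k => volume (A k)) _ (fun k _ => h1 k)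
    simpa using this
  rw [Measure.addHaar_closedBall_center] at h3
  calc volume (hsmLayer K t (t + δ)) = 1 * volume (hsmLayer K t (t + δ)) := (one_mul _).symm
    _ ≤ (ENNReal.ofReal (2 * δ) * N) * volume (hsmLayer K t (t + δ)) := by
        gcongr
        rw [← ENNReal.ofReal_natCast, ← ENNReal.ofReal_mul (by positivity)]
        simpa using hN2
    _ ≤ _ := by rw [mul_assoc]; gcongr

theorem hsm_sqrt_int {n : ℕ} {K : Set (En n)} (hK : IsConvexBody K) {p : En n → En n}
    (hp : IsMetricProj K p) {z : En n} {R : ℝ} (hz : pbody K 2 ⊆ closedBall z R) :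
    ∫⁻ x in hsmLayer K 0 1, ENNReal.ofReal (1 / √(infDist x K)) ≤
      8 * volume (closedBall (0 : En n) R) := by
  set V := volume (closedBall (0 : En n) R)
  let A : ℕ → Set (En n) := fun m => hsmLayer K ((1 / 4) ^ (m + 1)) ((1 / 4) ^ m)
  have hA : hsmLayer K 0 1 ⊆ ⋃ m, A m := by
    intro x hx
    obtain ⟨m, h1, h2⟩ := exists_nat_pow_near_of_lt_one hx.1 hx.2 (y := (1 / 4 : ℝ))
      (by norm_num) (by norm_num)
    exact mem_iUnion.2 ⟨m, h1, h2⟩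
  have hb : ∀ m, ∫⁻ x in A m, ENNReal.ofReal (1 / √(infDist x K)) ≤
      ENNReal.ofReal (4 * (1 / 2) ^ m) * V := by
    intro m
    have e : √((1 / 4 : ℝ) ^ (m + 1)) = (1 / 2) ^ (m + 1) := by
      rw [show (1 / 4 : ℝ) = (1 / 2) ^ 2 by norm_num, ← pow_mul, mul_comm, pow_mul]
      exact Real.sqrt_sq (by positivity)
    calc ∫⁻ x in A m, ENNReal.ofReal (1 / √(infDist x K))
        ≤ ∫⁻ x in A m, ENNReal.ofReal (2 ^ (m + 1)) := by
          refine setLIntegral_mono' (hsm_layer_meas _ _ _) fun x hx => ?_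
          refine ENNReal.ofReal_le_ofReal ?_
          have : (1 / 2 : ℝ) ^ (m + 1) ≤ √(infDist x K) := by
            rw [← e]; exact Real.sqrt_le_sqrt hx.1.le
          calc 1 / √(infDist x K) ≤ 1 / (1 / 2 : ℝ) ^ (m + 1) :=
                one_div_le_one_div_of_le (by positivity) this
            _ = 2 ^ (m + 1) := by simp
      _ = ENNReal.ofReal (2 ^ (m + 1)) * volume (A m) := by simp
      _ ≤ ENNReal.ofReal (2 ^ (m + 1)) * (ENNReal.ofReal (2 * (1 / 4) ^ m) * V) := by
          gcongr
          refine (measure_mono ?_).trans (hsm_layer_vol hK hp hz le_rfl zero_le_one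
            (δ := (1 / 4) ^ m) (by positivity) (pow_le_one₀ (by norm_num) (by norm_num)))
          intro x hx
          exact ⟨lt_trans (by positivity) hx.1, by rw [zero_add]; exact hx.2⟩
      _ = _ := by
          rw [← mul_assoc, ← ENNReal.ofReal_mul (by positivity)]
          congr 2
          rw [show (1 / 4 : ℝ) = (1 / 2) * (1 / 2) by norm_num, mul_pow]
          have : (2 : ℝ) ^ m * (1 / 2) ^ m = 1 := by rw [← mul_pow]; norm_num
          linear_combination (4 * (1 / 2 : ℝ) ^ m) * this
  calc _ ≤ ∫⁻ x in ⋃ m, A m, ENNReal.ofReal (1 / √(infDist x K)) := lintegral_mono_set hA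
    _ ≤ ∑' m, ∫⁻ x in A m, ENNReal.ofReal (1 / √(infDist x K)) := lintegral_iUnion_le _ _
    _ ≤ ∑' m : ℕ, ENNReal.ofReal (4 * (1 / 2) ^ m) * V := ENNReal.tsum_le_tsum hb
    _ = 8 * V := by
      rw [ENNReal.tsum_mul_right, ← ENNReal.ofReal_tsum_of_nonneg]
      · rw [tsum_mul_left, tsum_geometric_two]
        norm_num
      · intro m; positivity
      · exact summable_geometric_two.mul_left 4

theorem hsm_near {n : ℕ} {K L : Set (En n)} (hK : IsConvexBody K) (hL : IsConvexBody L)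
    {p : En n → En n} (hp : IsMetricProj K p) (x : En n) (hx : x ∈ L) :
    ‖x - p x‖ ≤ hausdorffDist K L := by
  rw [hsm_proj_norm hp, hausdorffDist_comm]
  exact infDist_le_hausdorffDist_of_mem hx (hausdorffEDist_ne_top_of_nonempty_of_bounded hL.1 hK.1
    hL.2.1.isBounded hK.2.1.isBounded)

theorem hsm_proj_diff {n : ℕ} {K L : Set (En n)} (hK : IsConvexBody K) (hL : IsConvexBody L)
    {p q : En n → En n} (hp : IsMetricProj K p) (hq : IsMetricProj L q) (x : En n) :
    ‖p x - q x‖ ^ 2 ≤ (infDist x K + infDist x L) * hausdorffDist K L := by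
  have h1 := hsm_proj_inner hK hp x (p (q x)) (hp _).1
  have h2 := hsm_proj_inner hL hq x (q (p x)) (hq _).1
  have n1 := hsm_near hK hL hp (q x) (hq x).1
  have n2 := hsm_near hL hK hq (p x) (hp x).1
  rw [hausdorffDist_comm] at n2
  have i1 := real_inner_le_norm (x - p x) (q x - p (q x))
  have i2 := real_inner_le_norm (x - q x) (p x - q (p x))
  rw [hsm_proj_norm hp] at i1
  rw [hsm_proj_norm hq] at i2
  have m1 := mul_le_mul_of_nonneg_left n1 (infDist_nonneg (x := x) (s := K))
  have m2 := mul_le_mul_of_nonneg_left n2 (infDist_nonneg (x := x) (s := L))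
  have e : ⟪p x - q x, p x - q x⟫ = (⟪x - p x, p (q x) - p x⟫ + ⟪x - p x, q x - p (q x)⟫) +
      (⟪x - q x, q (p x) - q x⟫ + ⟪x - q x, p x - q (p x)⟫) := by
    rw [← inner_add_right, ← inner_add_right]
    simp only [sub_add_sub_cancel', inner_sub_left, inner_sub_right]
    ring
  rw [real_inner_self_eq_norm_sq] at e
  linarith

theorem hsm_u_aux {E : Type*} [NormedAddCommGroup E] [NormedSpace ℝ E] (a b u v : E) (α β : ℝ)
    (ha : ‖a‖ = α) (hb : ‖b‖ = β) (hα : 0 ≤ α) (hu : α • u = a) (hv : β • v = b)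
    (nv : ‖v‖ = 1) : α * ‖u - v‖ ≤ 2 * ‖a - b‖ := by
  have e : α • (u - v) = (a - b) + (β - α) • v := by
    rw [smul_sub, sub_smul, hu, hv]; abel
  have h1 : α * ‖u - v‖ = ‖α • (u - v)‖ := by rw [norm_smul, Real.norm_of_nonneg hα]
  rw [h1, e]
  refine (norm_add_le _ _).trans ?_
  rw [norm_smul, nv, mul_one, Real.norm_eq_abs, ← ha, ← hb]
  have := abs_norm_sub_norm_le b a
  rw [norm_sub_rev b a] at this
  linarith

theorem hsm_pointwise {n : ℕ} {K L : Set (En n)} (hK : IsConvexBody K) (hL : IsConvexBody L)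
    {p q : En n → En n} (hp : IsMetricProj K p) (hq : IsMetricProj L q) (x : En n)
    (k0 : 0 < infDist x K) (k1 : infDist x K ≤ 1) (l0 : 0 < infDist x L) (l1 : infDist x L ≤ 1) :
    √(‖p x - q x‖ ^ 2 + ‖uvec K p x - uvec L q x‖ ^ 2) ≤
      4 * √(hausdorffDist K L) * (1 / √(infDist x K)) := by
  have hP := hsm_proj_diff hK hL hp hq x
  have hab : ‖(x - p x) - (x - q x)‖ = ‖p x - q x‖ := by
    rw [sub_sub_sub_cancel_left, norm_sub_rev]
  have hu1 := hsm_u_aux (x - p x) (x - q x) (uvec K p x) (uvec L q x) _ _ (hsm_proj_norm hp x)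
    (hsm_proj_norm hq x) k0.le (hsm_u_smul x k0) (hsm_u_smul x l0) (hsm_u_norm hq x l0)
  have hu2 := hsm_u_aux (x - q x) (x - p x) (uvec L q x) (uvec K p x) _ _ (hsm_proj_norm hq x)
    (hsm_proj_norm hp x) l0.le (hsm_u_smul x l0) (hsm_u_smul x k0) (hsm_u_norm hp x k0)
  rw [hab] at hu1
  rw [norm_sub_rev, norm_sub_rev (x - q x), hab] at hu2
  have hδ : 0 ≤ hausdorffDist K L := hausdorffDist_nonneg
  set δ := hausdorffDist K L
  set a := infDist x K
  set b := infDist x L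
  set P := ‖p x - q x‖
  set U := ‖uvec K p x - uvec L q x‖
  have hP0 : 0 ≤ P := norm_nonneg _
  have hU0 : 0 ≤ U := norm_nonneg _
  have hU : a * U ^ 2 ≤ 8 * δ := by
    rcases le_total b a with h | h
    · have s : (a * U) ^ 2 ≤ (2 * P) ^ 2 := pow_le_pow_left₀ (by positivity) hu1 2
      have : a * (a * U ^ 2) ≤ a * (8 * δ) := by nlinarith
      exact le_of_mul_le_mul_left this k0
    · have s : (b * U) ^ 2 ≤ (2 * P) ^ 2 := pow_le_pow_left₀ (by positivity) hu2 2
      have : b * (b * U ^ 2) ≤ b * (8 * δ) := by nlinarith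
      have := le_of_mul_le_mul_left this l0
      nlinarith [sq_nonneg U]
  have hPa : a * P ^ 2 ≤ 2 * δ := by nlinarith [sq_nonneg P]
  rw [mul_one_div, le_div_iff₀ (Real.sqrt_pos.2 k0), ← Real.sqrt_mul (by positivity)]
  refine Real.sqrt_le_iff.2 ⟨by positivity, ?_⟩
  rw [mul_pow, Real.sq_sqrt hδ]
  nlinarith

theorem hsm_bl_cont {n : ℕ} {f : En n × En n → ℝ} (hf : IsBLFun f) : Continuous f := by
  refine (LipschitzWith.of_dist_le_mul (K := 2) fun a b => ?_).continuous
  rw [Real.dist_eq]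
  refine (hf.1 a b).trans (Real.sqrt_le_iff.2 ⟨by positivity, ?_⟩)
  have h1 : ‖a.1 - b.1‖ ≤ dist a b := by
    rw [← dist_eq_norm, Prod.dist_eq]; exact le_max_left _ _
  have h2 : ‖a.2 - b.2‖ ≤ dist a b := by
    rw [← dist_eq_norm, Prod.dist_eq]; exact le_max_right _ _
  have h3 := pow_le_pow_left₀ (norm_nonneg _) h1 2
  have h4 := pow_le_pow_left₀ (norm_nonneg _) h2 2
  rw [mul_pow]
  norm_num
  nlinarith [sq_nonneg (dist a b)]

theorem hsm_map_meas {n : ℕ} {K : Set (En n)} (hK : IsConvexBody K)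
    {p : En n → En n} (hp : IsMetricProj K p) :
    Measurable fun x => (p x, uvec K p x) := by
  have h1 : Measurable p := (hsm_proj_lip hK hp).continuous.measurable
  have h : Measurable fun x : En n => infDist x K := (continuous_infDist_pt K).measurable
  exact h1.prodMk (h.inv.smul (measurable_id.sub h1))

/-- The integrand on `ℝⁿ`. -/
def hsmG {n : ℕ} (K : Set (En n)) (p : En n → En n) (ρ : ℝ) (f : En n × En n → ℝ) : En n → ℝ :=
  (hsmLayer K 0 ρ).indicator fun x => f (p x, uvec K p x)

theorem hsm_int_eq {n : ℕ} {K : Set (En n)} (hK : IsConvexBody K)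
    {p : En n → En n} (hp : IsMetricProj K p) {f : En n × En n → ℝ} (hf : IsBLFun f)
    {ρ : ℝ} (hρ : 0 ≤ ρ) : ∫ a, f a ∂(parMeas K p ρ) = ∫ x, hsmG K p ρ f x := by
  have hs : shell K ρ = hsmLayer K 0 ρ := hsm_shell hK hρ
  rw [parMeas, integral_map (hsm_map_meas hK hp).aemeasurable
    (hsm_bl_cont hf).aestronglyMeasurable, hs]
  exact (integral_indicator (hsm_layer_meas K 0 ρ)).symm

theorem hsm_layer_sub {n : ℕ} {K : Set (En n)} (hK : IsConvexBody K) {z : En n} {R : ℝ}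
    (hz : pbody K 2 ⊆ closedBall z R) {ρ : ℝ} (hρ1 : ρ ≤ 1) :
    hsmLayer K 0 ρ ⊆ closedBall z R := fun x hx =>
  hz ((hsm_mem_pbody hK (by norm_num) x).2 (by linarith [hx.2]))

theorem hsm_G_le {n : ℕ} {K : Set (En n)}
    {p : En n → En n} {f : En n × En n → ℝ} (hf : IsBLFun f) (ρ : ℝ) (x : En n) :
    |hsmG K p ρ f x| ≤ 1 := by
  by_cases h : x ∈ hsmLayer K 0 ρ
  · rw [hsmG, indicator_of_mem h]
    exact hf.2 _
  · rw [hsmG, indicator_of_notMem h]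
    simp

theorem hsm_G_int {n : ℕ} {K : Set (En n)} (hK : IsConvexBody K)
    {p : En n → En n} (hp : IsMetricProj K p) {f : En n × En n → ℝ} (hf : IsBLFun f)
    {z : En n} {R : ℝ} (hz : pbody K 2 ⊆ closedBall z R)
    {ρ : ℝ} (hρ1 : ρ ≤ 1) : Integrable (hsmG K p ρ f) := by
  rw [hsmG, integrable_indicator_iff (hsm_layer_meas K 0 ρ)]
  refine Measure.integrableOn_of_bounded (M := 1) ?_ ?_ ?_
  · exact ((measure_mono (hsm_layer_sub hK hz hρ1)).trans_lt measure_closedBall_lt_top).ne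
  · exact ((hsm_bl_cont hf).measurable.comp (hsm_map_meas hK hp)).aestronglyMeasurable
  · exact Filter.Eventually.of_forall fun x => hf.2 _

theorem hsm_G_bound {n : ℕ} {K : Set (En n)} (hK : IsConvexBody K)
    {p : En n → En n} {f : En n × En n → ℝ} (hf : IsBLFun f)
    {z : En n} {R : ℝ} (hz : pbody K 2 ⊆ closedBall z R)
    {ρ : ℝ} (hρ1 : ρ ≤ 1) :
    |∫ x, hsmG K p ρ f x| ≤ (volume (closedBall (0 : En n) R)).toReal := by
  rw [hsmG, integral_indicator (hsm_layer_meas K 0 ρ)]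
  have hlt : volume (hsmLayer K 0 ρ) < ⊤ :=
    (measure_mono (hsm_layer_sub hK hz hρ1)).trans_lt measure_closedBall_lt_top
  have h := norm_setIntegral_le_of_norm_le_const (f := fun x => f (p x, uvec K p x)) (C := 1)
    hlt (fun x _ => hf.2 _)
  rw [Real.norm_eq_abs, one_mul] at h
  refine h.trans (ENNReal.toReal_mono measure_closedBall_lt_top.ne ?_)
  rw [← Measure.addHaar_closedBall_center volume z R]
  exact measure_mono (hsm_layer_sub hK hz hρ1)

theorem hsm_G_pt {n : ℕ} {K L : Set (En n)} (hK : IsConvexBody K) (hL : IsConvexBody L)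
    {p q : En n → En n} (hp : IsMetricProj K p) (hq : IsMetricProj L q)
    {f : En n × En n → ℝ} (hf : IsBLFun f) {ρ : ℝ} (hρ1 : ρ ≤ 1) (x : En n) :
    ‖hsmG K p ρ f x - hsmG L q ρ f x‖ₑ ≤
      (hsmLayer K 0 (0 + hausdorffDist K L)).indicator 1 x +
      (hsmLayer K ρ (ρ + hausdorffDist K L)).indicator 1 x +
      (hsmLayer L 0 (0 + hausdorffDist K L)).indicator 1 x +
      (hsmLayer L ρ (ρ + hausdorffDist K L)).indicator 1 x +
      (hsmLayer K 0 1).indicator (fun x => ENNReal.ofReal (4 * √(hausdorffDist K L)) *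
        ENNReal.ofReal (1 / √(infDist x K))) x := by
  have fin : hausdorffEDist K L ≠ ⊤ := hausdorffEDist_ne_top_of_nonempty_of_bounded hK.1 hL.1
    hK.2.1.isBounded hL.2.1.isBounded
  have d1 := infDist_le_infDist_add_hausdorffDist (x := x) fin
  rw [hausdorffEDist_comm] at fin
  have d2 := infDist_le_infDist_add_hausdorffDist (x := x) fin
  rw [hausdorffDist_comm] at d2
  have fle : ∀ a, ‖f a‖ₑ ≤ 1 := fun a => by
    rw [Real.enorm_eq_ofReal_abs]; simpa using hf.2 a
  by_cases hk : x ∈ hsmLayer K 0 ρ <;> by_cases hl : x ∈ hsmLayer L 0 ρ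
  · have hk1 : x ∈ hsmLayer K 0 1 := ⟨hk.1, hk.2.trans hρ1⟩
    refine le_trans ?_ le_add_self
    rw [indicator_of_mem hk1, hsmG, hsmG, indicator_of_mem hk, indicator_of_mem hl,
      Real.enorm_eq_ofReal_abs, ← ENNReal.ofReal_mul (by positivity)]
    refine ENNReal.ofReal_le_ofReal ((hf.1 _ _).trans ?_)
    exact hsm_pointwise hK hL hp hq x hk.1 (hk.2.trans hρ1) hl.1 (hl.2.trans hρ1)
  · have e : ‖hsmG K p ρ f x - hsmG L q ρ f x‖ₑ ≤ 1 := by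
      rw [hsmG, hsmG, indicator_of_mem hk, indicator_of_notMem hl, sub_zero]
      exact fle _
    refine e.trans ?_
    by_cases h0 : 0 < infDist x L
    · have hl2 : ρ < infDist x L := by
        by_contra! h
        exact hl ⟨h0, h⟩
      have : x ∈ hsmLayer L ρ (ρ + hausdorffDist K L) := ⟨hl2, by linarith [hk.2]⟩
      rw [indicator_of_mem this]
      exact le_add_self.trans le_self_add
    · have : x ∈ hsmLayer K 0 (0 + hausdorffDist K L) := ⟨hk.1, by linarith⟩
      rw [indicator_of_mem this, add_assoc, add_assoc, add_assoc]
      exact le_self_add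
  · have e : ‖hsmG K p ρ f x - hsmG L q ρ f x‖ₑ ≤ 1 := by
      rw [hsmG, hsmG, indicator_of_mem hl, indicator_of_notMem hk, zero_sub, enorm_neg]
      exact fle _
    refine e.trans ?_
    by_cases h0 : 0 < infDist x K
    · have hk2 : ρ < infDist x K := by
        by_contra! h
        exact hk ⟨h0, h⟩
      have : x ∈ hsmLayer K ρ (ρ + hausdorffDist K L) := ⟨hk2, by linarith [hl.2]⟩
      rw [indicator_of_mem this, add_assoc, add_assoc]
      exact (le_add_self (a := (1 : ENNReal))).trans le_self_add
    · have : x ∈ hsmLayer L 0 (0 + hausdorffDist K L) := ⟨hl.1, by linarith⟩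
      rw [indicator_of_mem this, add_assoc]
      exact (le_add_self (a := (1 : ENNReal))).trans le_self_add
  · rw [hsmG, hsmG, indicator_of_notMem hl, indicator_of_notMem hk]
    simp

theorem hsm_main {n : ℕ} {K L : Set (En n)} (hK : IsConvexBody K) (hL : IsConvexBody L)
    {p q : En n → En n} (hp : IsMetricProj K p) (hq : IsMetricProj L q)
    {z : En n} {R : ℝ} (hzK : pbody K 2 ⊆ closedBall z R) (hzL : pbody L 2 ⊆ closedBall z R)
    {f : En n × En n → ℝ} (hf : IsBLFun f) {ρ : ℝ} (hρ : 0 ≤ ρ) (hρ1 : ρ ≤ 1) :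
    |(∫ a, f a ∂(parMeas K p ρ)) - ∫ a, f a ∂(parMeas L q ρ)| ≤
      40 * (volume (closedBall (0 : En n) R)).toReal * √(hausdorffDist K L) := by
  rw [hsm_int_eq hK hp hf hρ, hsm_int_eq hL hq hf hρ]
  have hVlt : volume (closedBall (0 : En n) R) < ⊤ := measure_closedBall_lt_top
  have hδ : 0 ≤ hausdorffDist K L := hausdorffDist_nonneg
  rcases le_or_gt (hausdorffDist K L) 1 with hδ1 | hδ1
  · rw [← integral_sub (hsm_G_int hK hp hf hzK hρ1) (hsm_G_int hL hq hf hzL hρ1)]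
    have h1 := (enorm_integral_le_lintegral_enorm (μ := volume)
      (fun x => hsmG K p ρ f x - hsmG L q ρ f x)).trans
      (lintegral_mono (hsm_G_pt hK hL hp hq hf hρ1))
    have m : ∀ (M : Set (En n)) t s, Measurable ((hsmLayer M t s).indicator (1 : En n → ENNReal)) :=
      fun M t s => measurable_one.indicator (hsm_layer_meas M t s)
    have hm : Measurable fun x : En n => ENNReal.ofReal (1 / √(infDist x K)) :=
      (measurable_const.div (continuous_infDist_pt K).measurable.sqrt).ennreal_ofReal
    rw [lintegral_add_right _ ((hm.const_mul _).indicator (hsm_layer_meas _ _ _)),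
      lintegral_add_right _ (m _ _ _), lintegral_add_right _ (m _ _ _),
      lintegral_add_right _ (m _ _ _),
      lintegral_indicator_one (hsm_layer_meas _ _ _), lintegral_indicator_one (hsm_layer_meas _ _ _),
      lintegral_indicator_one (hsm_layer_meas _ _ _), lintegral_indicator_one (hsm_layer_meas _ _ _),
      lintegral_indicator (hsm_layer_meas _ _ _), lintegral_const_mul _ hm] at h1
    have a1 := hsm_layer_vol hK hp hzK le_rfl zero_le_one hδ hδ1
    have a2 := hsm_layer_vol hK hp hzK hρ hρ1 hδ hδ1
    have a3 := hsm_layer_vol hL hq hzL le_rfl zero_le_one hδ hδ1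
    have a4 := hsm_layer_vol hL hq hzL hρ hρ1 hδ hδ1
    have a5 := hsm_sqrt_int hK hp hzK
    have h2 := h1.trans (add_le_add (add_le_add (add_le_add (add_le_add a1 a2) a3) a4)
      (mul_le_mul_right a5 (ENNReal.ofReal (4 * √(hausdorffDist K L)))))
    rw [← ENNReal.ofReal_toReal hVlt.ne, Real.enorm_eq_ofReal_abs] at h2
    set V := (volume (closedBall (0 : En n) R)).toReal
    have hV : 0 ≤ V := ENNReal.toReal_nonneg
    set δ := hausdorffDist K L
    rw [← ENNReal.ofReal_mul (by positivity), show (8 : ENNReal) = ENNReal.ofReal 8 by simp,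
      ← ENNReal.ofReal_mul (by positivity), ← ENNReal.ofReal_mul (by positivity),
      ← ENNReal.ofReal_add (by positivity) (by positivity),
      ← ENNReal.ofReal_add (by positivity) (by positivity),
      ← ENNReal.ofReal_add (by positivity) (by positivity),
      ← ENNReal.ofReal_add (by positivity) (by positivity),
      ENNReal.ofReal_le_ofReal_iff (by positivity)] at h2
    refine h2.trans ?_
    have hs : δ ≤ √δ := Real.le_sqrt_of_sq_le (by nlinarith)
    nlinarith [mul_le_mul_of_nonneg_left hs hV]
  · have b1 := hsm_G_bound (p := p) hK hf hzK hρ1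
    have b2 := hsm_G_bound (p := q) hL hf hzL hρ1
    have hs : 1 ≤ √(hausdorffDist K L) := Real.one_le_sqrt.2 hδ1.le
    set V := (volume (closedBall (0 : En n) R)).toReal
    have hV : 0 ≤ V := ENNReal.toReal_nonneg
    refine (abs_sub _ _).trans ?_
    nlinarith [mul_le_mul_of_nonneg_left hs hV]

/-- **Theorem 1** (Hug–Schneider): Hölder continuity of the support measures
`Λ_i(K,·) = ∑_j a_{ij} μ_{K, j/n}` with respect to the bounded Lipschitz metric:
`d_bL(Λ_i(K,·), Λ_i(L,·)) ≤ C(R) d_H(K,L)^{1/2}`. -/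
theorem support_measures_holder (n : ℕ) (hn : 1 ≤ n) (R : ℝ) (hR : 0 < R) :
    ∃ C : ℝ, 0 < C ∧
      ∀ K L : Set (En n), IsConvexBody K → IsConvexBody L →
        (∃ z : En n, pbody K 2 ⊆ Metric.closedBall z R ∧ pbody L 2 ⊆ Metric.closedBall z R) →
        ∀ pK pL : En n → En n, IsMetricProj K pK → IsMetricProj L pL →
          ∀ i : Fin n, ∀ f : En n × En n → ℝ, IsBLFun f →
            |(∑ j : Fin n, steinerCoeff n i j * ∫ a, f a ∂(parMeas K pK ((j.1 + 1 : ℝ) / n))) -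
              (∑ j : Fin n, steinerCoeff n i j * ∫ a, f a ∂(parMeas L pL ((j.1 + 1 : ℝ) / n)))| ≤
              C * Real.sqrt (Metric.hausdorffDist K L) := by
  set V := (volume (closedBall (0 : En n) R)).toReal with hVdef
  have hV : 0 ≤ V := ENNReal.toReal_nonneg
  refine ⟨(∑ i : Fin n, ∑ j : Fin n, |steinerCoeff n i j|) * (40 * V) + 1, by positivity, ?_⟩
  rintro K L hK hL ⟨z, hzK, hzL⟩ pK pL hpK hpL i f hf
  have hn0 : (0 : ℝ) < n := by exact_mod_cast hn
  set s := √(hausdorffDist K L)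
  have hs : 0 ≤ s := Real.sqrt_nonneg _
  rw [← Finset.sum_sub_distrib]
  have h1 : (∑ j : Fin n, |steinerCoeff n i j|) ≤
      ∑ i : Fin n, ∑ j : Fin n, |steinerCoeff n i j| :=
    Finset.single_le_sum (f := fun i => ∑ j : Fin n, |steinerCoeff n i j|)
      (fun i _ => Finset.sum_nonneg fun j _ => abs_nonneg _) (Finset.mem_univ i)
  calc _ ≤ ∑ j : Fin n, |steinerCoeff n i j| * (40 * V * s) := by
        refine (Finset.abs_sum_le_sum_abs _ _).trans (Finset.sum_le_sum fun j _ => ?_)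
        rw [← mul_sub, abs_mul]
        refine mul_le_mul_of_nonneg_left ?_ (abs_nonneg _)
        refine hsm_main hK hL hpK hpL hzK hzL hf (by positivity) ?_
        rw [div_le_one hn0]
        exact_mod_cast j.2
    _ = (∑ j : Fin n, |steinerCoeff n i j|) * (40 * V * s) := by rw [Finset.sum_mul]
    _ ≤ (∑ i : Fin n, ∑ j : Fin n, |steinerCoeff n i j|) * (40 * V * s) := by gcongr
    _ ≤ _ := by nlinarith

end
end

section
/- Let n ≥ 1 and R > 0. There exists a constant C > 0, depending only on n and R, such that for all convex bodies K, L in ℝⁿ with K + 2Bⁿ and L + 2Bⁿ contained in a closed ball of radius R, and for every ρ with 0 < ρ ≤ 1, one has d_bL(μ_{K,ρ}, μ_{L,ρ}) ≤ C · d_H(K, L)^{1/2}. -/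
open MeasureTheory Metric Set Real Pointwise RealInnerProductSpace

noncomputable section

namespace ParHolder

lemma vol_le_of_expand {n : ℕ} (s t : Set (En n)) (ψ : En n → En n)
    (hm : ∀ y ∈ s, ψ y ∈ t)
    (he : ∀ y ∈ s, ∀ y' ∈ s, dist y y' ≤ dist (ψ y) (ψ y')) :
    volume s ≤ volume t := by
  have hH : (μH[n] : Measure (En n)).IsAddHaarMeasure := by
    simpa using MeasureTheory.isAddHaarMeasure_hausdorffMeasure (E := En n)
  have hv := Measure.isAddLeftInvariant_eq_smul (volume : Measure (En n)) (μH[n] : Measure (En n))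
  have hinj : Set.InjOn ψ s := by
    intro y hy y' hy' h
    have := he y hy y' hy'
    rw [h, dist_self] at this
    exact dist_le_zero.1 this
  have hL : LipschitzOnWith 1 (Function.invFunOn ψ s) (ψ '' s) := by
    refine LipschitzOnWith.of_dist_le_mul ?_
    rintro _ ⟨y, hy, rfl⟩ _ ⟨y', hy', rfl⟩
    rw [hinj.leftInvOn_invFunOn hy, hinj.leftInvOn_invFunOn hy']
    simpa using he y hy y' hy'
  have h1 := hL.hausdorffMeasure_image_le (d := n) (by positivity)
  have h2 : (Function.invFunOn ψ s) '' (ψ '' s) = s := by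
    rw [hinj.leftInvOn_invFunOn.image_image]
  rw [h2] at h1
  have h3 : (μH[n] : Measure (En n)) s ≤ μH[n] t := by
    refine h1.trans ?_
    simp only [ENNReal.coe_one, ENNReal.one_rpow, one_mul]
    exact measure_mono (by rintro _ ⟨y, hy, rfl⟩; exact hm y hy)
  rw [hv]
  simp only [Measure.smul_apply]
  gcongr

lemma proj_var {n : ℕ} {K : Set (En n)} {p : En n → En n} (hK : Convex ℝ K)
    (hp : IsMetricProj K p) (x z : En n) (hz : z ∈ K) : ⟪x - p x, z - p x⟫ ≤ 0 := by
  refine (norm_eq_iInf_iff_real_inner_le_zero hK (hp x).1).1 ?_ z hz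
  rw [← dist_eq_norm, (hp x).2, Metric.infDist_eq_iInf]
  simp only [dist_eq_norm]

lemma proj_lip {n : ℕ} {K : Set (En n)} {p : En n → En n} (hK : Convex ℝ K)
    (hp : IsMetricProj K p) : LipschitzWith 1 p := by
  refine LipschitzWith.of_dist_le_mul fun x y => ?_
  have h1 := proj_var hK hp x (p y) (hp y).1
  have h2 := proj_var hK hp y (p x) (hp x).1
  have h3 : ‖p x - p y‖ ^ 2 ≤ ⟪x - y, p x - p y⟫ := by
    rw [← real_inner_self_eq_norm_sq]
    simp only [inner_sub_left, inner_sub_right, real_inner_comm] at *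
    linarith
  have h4 := real_inner_le_norm (x - y) (p x - p y)
  rw [dist_eq_norm, dist_eq_norm]
  simp only [NNReal.coe_one, one_mul]
  by_contra! h
  have := norm_nonneg (x - y)
  nlinarith

/-- `x = p x + d • u`. -/
lemma decomp {n : ℕ} {K : Set (En n)} {p : En n → En n} {x : En n}
    (hx : 0 < infDist x K) : x - p x = infDist x K • uvec K p x := by
  simp [uvec, smul_smul, hx.ne']

lemma norm_uvec {n : ℕ} {K : Set (En n)} {p : En n → En n} (hp : IsMetricProj K p) {x : En n}
    (hx : 0 < infDist x K) : ‖uvec K p x‖ = 1 := by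
  rw [uvec, norm_smul, ← dist_eq_norm, (hp x).2, norm_inv, Real.norm_of_nonneg hx.le,
    inv_mul_cancel₀ hx.ne']

lemma uvec_var {n : ℕ} {K : Set (En n)} {p : En n → En n} (hK : Convex ℝ K)
    (hp : IsMetricProj K p) (x z : En n) (hz : z ∈ K) : ⟪uvec K p x, z - p x⟫ ≤ 0 := by
  rw [uvec, real_inner_smul_left]
  exact mul_nonpos_of_nonneg_of_nonpos (inv_nonneg.2 infDist_nonneg) (proj_var hK hp x z hz)

lemma infDist_push {n : ℕ} {K : Set (En n)} {p : En n → En n} (hK : Convex ℝ K)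
    (hp : IsMetricProj K p) {x : En n} (hx : 0 < infDist x K) {a : ℝ} (ha : 0 ≤ a) :
    infDist (x + a • uvec K p x) K = infDist x K + a := by
  have hne : K.Nonempty := ⟨_, (hp x).1⟩
  have hu := norm_uvec hp hx
  have hd := decomp (p := p) hx
  have key : ∀ z, x + a • uvec K p x - z = (p x - z) + (infDist x K + a) • uvec K p x := by
    intro z
    rw [add_smul, ← hd]; abel
  apply le_antisymm
  · refine (infDist_le_dist_of_mem (hp x).1).trans ?_
    rw [dist_eq_norm, key, sub_self, zero_add, norm_smul, hu, mul_one, Real.norm_of_nonneg]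
    positivity
  · refine (le_infDist hne).2 fun z hz => ?_
    have h1 := uvec_var hK hp x z hz
    have h2 := real_inner_le_norm (uvec K p x) (x + a • uvec K p x - z)
    rw [hu, one_mul, ← dist_eq_norm, key, inner_add_right, real_inner_smul_right,
      real_inner_self_eq_norm_sq, hu] at h2
    have : ⟪uvec K p x, p x - z⟫ = - ⟪uvec K p x, z - p x⟫ := by
      rw [← inner_neg_right, neg_sub]
    linarith

lemma push_expand {n : ℕ} {K : Set (En n)} {p : En n → En n} (hK : Convex ℝ K)
    (hp : IsMetricProj K p) {x y : En n} (hx : 0 < infDist x K) (hy : 0 < infDist y K)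
    {a : ℝ} (ha : 0 ≤ a) :
    dist x y ≤ dist (x + a • uvec K p x) (y + a • uvec K p y) := by
  have hux := norm_uvec hp hx
  have huy := norm_uvec hp hy
  have hdx := decomp (p := p) hx
  have hdy := decomp (p := p) hy
  have h1 := uvec_var hK hp x (p y) (hp y).1
  have h2 := uvec_var hK hp y (p x) (hp x).1
  set u := uvec K p x
  set v := uvec K p y
  set d := infDist x K
  set e := infDist y K
  have hxy : x - y = (p x - p y) + (d • u - e • v) := by rw [← hdx, ← hdy]; abel
  have huv : ⟪u, v⟫ ≤ 1 := by
    have := real_inner_le_norm u v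
    rwa [hux, huy, one_mul] at this
  have hmono : 0 ≤ ⟪x - y, u - v⟫ := by
    have e1 : ⟪x - y, u - v⟫ = - ⟪u, p y - p x⟫ - ⟪v, p x - p y⟫ + (d + e) * (1 - ⟪u, v⟫) := by
      have a1 : ⟪u, u⟫ = 1 := by rw [real_inner_self_eq_norm_sq, hux]; norm_num
      have a2 : ⟪v, v⟫ = 1 := by rw [real_inner_self_eq_norm_sq, huy]; norm_num
      rw [hxy]
      simp only [inner_add_left, inner_sub_left, inner_sub_right, real_inner_smul_left, a1, a2]
      rw [real_inner_comm u v, real_inner_comm u (p x), real_inner_comm u (p y),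
        real_inner_comm v (p x), real_inner_comm v (p y)]
      ring
    have : 0 ≤ (d + e) * (1 - ⟪u, v⟫) := mul_nonneg (by positivity) (by linarith)
    linarith
  rw [dist_eq_norm, dist_eq_norm]
  have e2 : x + a • u - (y + a • v) = (x - y) + a • (u - v) := by rw [smul_sub]; abel
  rw [e2]
  refine (sq_le_sq₀ (norm_nonneg _) (norm_nonneg _)).1 ?_
  rw [norm_add_sq_real, real_inner_smul_right]
  have := mul_nonneg ha hmono
  nlinarith [sq_nonneg ‖a • (u - v)‖]

def Sh {n : ℕ} (K : Set (En n)) (a b : ℝ) : Set (En n) :=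
  {x | a < infDist x K ∧ infDist x K ≤ b}

lemma measurableSet_Sh {n : ℕ} (K : Set (En n)) (a b : ℝ) : MeasurableSet (Sh K a b) :=
  (measurableSet_lt measurable_const (continuous_infDist_pt K).measurable).inter
    (measurableSet_le (continuous_infDist_pt K).measurable measurable_const)

lemma vol_Sh_mono {n : ℕ} {K : Set (En n)} {p : En n → En n} (hK : Convex ℝ K)
    (hp : IsMetricProj K p) {a h c : ℝ} (ha : 0 ≤ a) (hc : 0 ≤ c) :
    volume (Sh K a (a + h)) ≤ volume (Sh K (a + c) (a + c + h)) := by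
  refine vol_le_of_expand _ _ (fun y => y + c • uvec K p y) ?_ ?_
  · rintro y ⟨h1, h2⟩
    have := infDist_push hK hp (lt_of_le_of_lt ha h1) hc
    constructor <;> rw [this] <;> linarith
  · rintro y ⟨h1, h2⟩ y' ⟨h1', h2'⟩
    exact push_expand hK hp (lt_of_le_of_lt ha h1) (lt_of_le_of_lt ha h1') hc

lemma vol_Sh_le {n : ℕ} {K : Set (En n)} {p : En n → En n} (hK : Convex ℝ K)
    (hp : IsMetricProj K p) {a h : ℝ} (ha : 0 ≤ a) (hh : 0 < h) (hh1 : h ≤ 1) {V : ENNReal}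
    (hV : volume {x | infDist x K ≤ a + 1} ≤ V) :
    volume (Sh K a (a + h)) ≤ ENNReal.ofReal (2 * h) * V := by
  set N := ⌊1 / h⌋₊ with hN
  have hN1 : 1 ≤ N := Nat.le_floor (by simpa using (one_le_div hh).2 hh1)
  have hNle : (N : ℝ) ≤ 1 / h := Nat.floor_le (by positivity)
  have hNlt : 1 / h < N + 1 := Nat.lt_floor_add_one _
  have hN1' : (1 : ℝ) ≤ N := by exact_mod_cast hN1
  have h2N : 1 ≤ 2 * h * N := by
    rw [div_lt_iff₀ hh] at hNlt
    nlinarith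
  have hNh : N * h ≤ 1 := by rwa [le_div_iff₀ hh] at hNle
  have hsum : (N : ENNReal) * volume (Sh K a (a + h)) ≤ V := by
    calc (N : ENNReal) * volume (Sh K a (a + h))
        = ∑ j ∈ Finset.range N, volume (Sh K a (a + h)) := by simp
      _ ≤ ∑ j ∈ Finset.range N, volume (Sh K (a + j * h) (a + j * h + h)) :=
          Finset.sum_le_sum fun j _ => vol_Sh_mono hK hp ha (by positivity)
      _ = volume (⋃ j ∈ Finset.range N, Sh K (a + j * h) (a + j * h + h)) := by
          rw [measure_biUnion_finset]
          · intro i _ j _ hij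
            refine Set.disjoint_left.2 ?_
            rintro x ⟨h1, h2⟩ ⟨h3, h4⟩
            rcases lt_or_gt_of_ne hij with hlt | hlt
            · have : (i : ℝ) + 1 ≤ j := by exact_mod_cast hlt
              nlinarith
            · have : (j : ℝ) + 1 ≤ i := by exact_mod_cast hlt
              nlinarith
          · intro j _
            exact measurableSet_Sh _ _ _
      _ ≤ volume {x | infDist x K ≤ a + 1} := by
          refine measure_mono ?_
          intro x hx
          simp only [Set.mem_iUnion, Finset.mem_range] at hx
          obtain ⟨j, hj, h1, h2⟩ := hx
          have : (j : ℝ) + 1 ≤ N := by exact_mod_cast hj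
          show infDist x K ≤ a + 1
          nlinarith
      _ ≤ V := hV
  calc volume (Sh K a (a + h)) = 1 * volume (Sh K a (a + h)) := (one_mul _).symm
    _ ≤ ENNReal.ofReal (2 * h * N) * volume (Sh K a (a + h)) := by
        gcongr
        rw [← ENNReal.ofReal_one]
        exact ENNReal.ofReal_le_ofReal h2N
    _ = ENNReal.ofReal (2 * h) * (N * volume (Sh K a (a + h))) := by
        rw [ENNReal.ofReal_mul (by positivity), ENNReal.ofReal_natCast, mul_assoc]
    _ ≤ _ := by gcongr

lemma lint_le {n : ℕ} {K : Set (En n)} {p : En n → En n} (hK : Convex ℝ K)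
    (hp : IsMetricProj K p) {V : ENNReal}
    (hV : volume {x | infDist x K ≤ 1} ≤ V) :
    ∫⁻ x in Sh K 0 1, ENNReal.ofReal (1 / √(infDist x K)) ≤ ENNReal.ofReal 8 * V := by
  have hpt : ∀ x ∈ Sh K 0 1, ENNReal.ofReal (1 / √(infDist x K)) ≤
      ∑' k : ℕ, (Sh K 0 (0 + (1 / 4 : ℝ) ^ k)).indicator
        (fun _ => ENNReal.ofReal (2 ^ (k + 1))) x := by
    rintro x ⟨h0, h1⟩
    obtain ⟨k, hk1, hk2⟩ := exists_nat_pow_near_of_lt_one h0 h1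
      (show (0 : ℝ) < 1 / 4 by norm_num) (by norm_num)
    refine le_trans ?_ (ENNReal.le_tsum k)
    rw [Set.indicator_of_mem (show x ∈ Sh K 0 (0 + (1 / 4 : ℝ) ^ k) from ⟨h0, by simpa using hk2⟩)]
    apply ENNReal.ofReal_le_ofReal
    rw [div_le_iff₀ (Real.sqrt_pos.2 h0)]
    have : ((1 : ℝ) / 2) ^ (k + 1) ≤ √(infDist x K) := by
      apply Real.le_sqrt_of_sq_le
      rw [← pow_mul, mul_comm, pow_mul]
      norm_num at hk1 ⊢
      exact hk1.le
    calc (1 : ℝ) = 2 ^ (k + 1) * (1 / 2) ^ (k + 1) := by rw [← mul_pow]; norm_num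
      _ ≤ _ := by gcongr
  calc ∫⁻ x in Sh K 0 1, ENNReal.ofReal (1 / √(infDist x K))
      ≤ ∫⁻ x in Sh K 0 1, ∑' k : ℕ, (Sh K 0 (0 + (1 / 4 : ℝ) ^ k)).indicator
        (fun _ => ENNReal.ofReal (2 ^ (k + 1))) x := setLIntegral_mono' (measurableSet_Sh _ _ _) hpt
    _ ≤ ∫⁻ x, ∑' k : ℕ, (Sh K 0 (0 + (1 / 4 : ℝ) ^ k)).indicator
        (fun _ => ENNReal.ofReal (2 ^ (k + 1))) x := setLIntegral_le_lintegral _ _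
    _ = ∑' k : ℕ, ENNReal.ofReal (2 ^ (k + 1)) * volume (Sh K 0 (0 + (1 / 4 : ℝ) ^ k)) := by
        rw [lintegral_tsum fun k =>
          (measurable_const.indicator (measurableSet_Sh _ _ _)).aemeasurable]
        simp only [lintegral_indicator_const (measurableSet_Sh _ _ _)]
    _ ≤ ∑' k : ℕ, ENNReal.ofReal (4 * (1 / 2) ^ k) * V := by
        refine ENNReal.tsum_le_tsum fun k => ?_
        have := vol_Sh_le hK hp le_rfl (h := (1 / 4 : ℝ) ^ k) (by positivity)
          (pow_le_one₀ (by norm_num) (by norm_num)) (by simpa using hV)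
        calc _ ≤ ENNReal.ofReal (2 ^ (k + 1)) * (ENNReal.ofReal (2 * (1 / 4 : ℝ) ^ k) * V) := by
              gcongr
          _ = _ := by
              rw [← mul_assoc, ← ENNReal.ofReal_mul (by positivity)]
              congr 2
              rw [pow_succ, show (1 / 4 : ℝ) = (1 / 2) * (1 / 2) by norm_num, mul_pow]
              have : (2 : ℝ) ^ k * (1 / 2) ^ k = 1 := by rw [← mul_pow]; norm_num
              linear_combination (4 * (1 / 2 : ℝ) ^ k) * this
    _ = ENNReal.ofReal 8 * V := by
        rw [ENNReal.tsum_mul_right, ← ENNReal.ofReal_tsum_of_nonneg (fun k => by positivity)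
          (summable_geometric_two.mul_left 4), tsum_mul_left, tsum_geometric_two]
        norm_num

lemma infDist_close {n : ℕ} {K L : Set (En n)} (hK : IsConvexBody K) (hL : IsConvexBody L)
    (x : En n) : infDist x L ≤ infDist x K + hausdorffDist K L :=
  infDist_le_infDist_add_hausdorffDist
    (hausdorffEDist_ne_top_of_nonempty_of_bounded hK.1 hL.1 hK.2.1.isBounded hL.2.1.isBounded)

lemma proj_half {n : ℕ} {K L : Set (En n)} {pK pL : En n → En n} (hK : IsConvexBody K)
    (hL : IsConvexBody L) (hpK : IsMetricProj K pK) (hpL : IsMetricProj L pL) (x : En n) :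
    ⟪x - pK x, pL x - pK x⟫ ≤ infDist x K * hausdorffDist K L := by
  obtain ⟨q, hq, hqd⟩ := hK.2.1.exists_infDist_eq_dist hK.1 (pL x)
  have h1 : dist (pL x) q ≤ hausdorffDist K L := by
    rw [← hqd]
    have := infDist_close hL hK (pL x)
    rwa [infDist_zero_of_mem (hpL x).1, zero_add, hausdorffDist_comm] at this
  have h2 := proj_var hK.2.2 hpK x q hq
  have h3 := real_inner_le_norm (x - pK x) (pL x - q)
  have h4 : ⟪x - pK x, pL x - pK x⟫ = ⟪x - pK x, pL x - q⟫ + ⟪x - pK x, q - pK x⟫ := by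
    rw [← inner_add_right]; congr 1; abel
  rw [← dist_eq_norm, ← dist_eq_norm, (hpK x).2] at h3
  have := mul_le_mul_of_nonneg_left h1 (infDist_nonneg (x := x) (s := K))
  linarith

lemma proj_close {n : ℕ} {K L : Set (En n)} {pK pL : En n → En n} (hK : IsConvexBody K)
    (hL : IsConvexBody L) (hpK : IsMetricProj K pK) (hpL : IsMetricProj L pL) (x : En n) :
    ‖pK x - pL x‖ ^ 2 ≤ (infDist x K + infDist x L) * hausdorffDist K L := by
  have h1 := proj_half hK hL hpK hpL x
  have h2 := proj_half hL hK hpL hpK x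
  rw [hausdorffDist_comm] at h2
  have : ‖pK x - pL x‖ ^ 2 = ⟪x - pK x, pL x - pK x⟫ + ⟪x - pL x, pK x - pL x⟫ := by
    rw [← real_inner_self_eq_norm_sq]
    simp only [inner_sub_left, inner_sub_right, real_inner_comm]
    ring
  linarith

lemma pointwise {n : ℕ} {K L : Set (En n)} {pK pL : En n → En n} (hK : IsConvexBody K)
    (hL : IsConvexBody L) (hpK : IsMetricProj K pK) (hpL : IsMetricProj L pL) {x : En n}
    (hxK : 0 < infDist x K) (hxK1 : infDist x K ≤ 1) (hxL : 0 < infDist x L)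
    {f : En n × En n → ℝ} (hf : IsBLFun f) :
    |f (pK x, uvec K pK x) - f (pL x, uvec L pL x)| ≤
      5 * √(hausdorffDist K L) * (1 / √(infDist x K)) := by
  have hc := proj_close hK hL hpK hpL x
  have hd1 := infDist_close hK hL x
  have hd2 := infDist_close hL hK x
  rw [hausdorffDist_comm] at hd2
  have hδ : 0 ≤ hausdorffDist K L := hausdorffDist_nonneg
  have hnL := (hpL x).2
  have hxd := decomp (p := pL) hxL
  have hxdK := decomp (p := pK) hxK
  have huL := norm_uvec hpL hxL
  set d := infDist x K
  set e := infDist x L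
  set δ := hausdorffDist K L
  have hsd : 0 < √d := Real.sqrt_pos.2 hxK
  have hsd1 : √d ≤ 1 := Real.sqrt_le_one.2 hxK1
  have hsqd : √d ^ 2 = d := Real.sq_sqrt hxK.le
  have hsδ : 0 ≤ √δ := Real.sqrt_nonneg _
  have hsqδ : √δ ^ 2 = δ := Real.sq_sqrt hδ
  rw [mul_one_div, le_div_iff₀ hsd]
  rcases lt_or_ge d δ with hlt | hge
  · have h1 : √d ≤ √δ := Real.sqrt_le_sqrt hlt.le
    have h2 := abs_sub (f (pK x, uvec K pK x)) (f (pL x, uvec L pL x))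
    have h3 := hf.2 (pK x, uvec K pK x)
    have h4 := hf.2 (pL x, uvec L pL x)
    nlinarith
  · have h1 : √δ ≤ √d := Real.sqrt_le_sqrt hge
    have hp : ‖pK x - pL x‖ ≤ 2 * √δ * √d := by
      refine (sq_le_sq₀ (norm_nonneg _) (by positivity)).1 ?_
      rw [mul_pow, mul_pow, hsqd, hsqδ]
      nlinarith [mul_nonneg hδ hxK.le]
    have hu : ‖uvec K pK x - uvec L pL x‖ * d ≤ 3 * √δ * √d := by
      have e1 : d • (uvec K pK x - uvec L pL x) = -(pK x - pL x) + (e - d) • uvec L pL x := by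
        rw [smul_sub, sub_smul, ← hxd, ← hxdK]; abel
      have e2 : ‖uvec K pK x - uvec L pL x‖ * d = ‖d • (uvec K pK x - uvec L pL x)‖ := by
        rw [norm_smul, Real.norm_of_nonneg hxK.le, mul_comm]
      rw [e2, e1]
      refine (norm_add_le _ _).trans ?_
      rw [norm_neg, norm_smul, huL, mul_one, Real.norm_eq_abs]
      have : |e - d| ≤ δ := abs_le.2 ⟨by linarith, by linarith⟩
      nlinarith
    have hu' : ‖uvec K pK x - uvec L pL x‖ * √d ≤ 3 * √δ := by
      have : (‖uvec K pK x - uvec L pL x‖ * √d) * √d ≤ (3 * √δ) * √d := by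
        rw [mul_assoc, ← sq, hsqd]; exact hu
      exact le_of_mul_le_mul_right this hsd
    have hf1 := hf.1 (pK x, uvec K pK x) (pL x, uvec L pL x)
    have hs : √(‖pK x - pL x‖ ^ 2 + ‖uvec K pK x - uvec L pL x‖ ^ 2) ≤
        ‖pK x - pL x‖ + ‖uvec K pK x - uvec L pL x‖ := by
      rw [Real.sqrt_le_left (by positivity)]
      nlinarith [mul_nonneg (norm_nonneg (pK x - pL x))
        (norm_nonneg (uvec K pK x - uvec L pL x))]
    have hf2 := hf1.trans hs
    calc _ ≤ (‖pK x - pL x‖ + ‖uvec K pK x - uvec L pL x‖) * √d := by gcongr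
      _ ≤ 2 * √δ * √d * √d + 3 * √δ := by rw [add_mul]; gcongr
      _ = 2 * √δ * d + 3 * √δ := by rw [mul_assoc _ √d √d, ← sq, hsqd]
      _ ≤ _ := by nlinarith

lemma vol_Sh_le' {n : ℕ} {K : Set (En n)} {p : En n → En n} (hK : Convex ℝ K)
    (hp : IsMetricProj K p) {a h : ℝ} (ha : 0 ≤ a) (hh : 0 ≤ h) (hh1 : h ≤ 1) {V : ENNReal}
    (hV : volume {x | infDist x K ≤ a + 1} ≤ V) :
    volume (Sh K a (a + h)) ≤ ENNReal.ofReal (2 * h) * V := by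
  rcases hh.eq_or_lt with rfl | hpos
  · have : Sh K a (a + 0) = ∅ := by
      ext x
      simp only [Sh, add_zero, Set.mem_ofPred_eq, Set.mem_empty_iff_false, iff_false, not_and, not_le]
      exact id
    rw [this]; simp
  · exact vol_Sh_le hK hp ha hpos hh1 hV

lemma mem_pbody_iff {n : ℕ} {K : Set (En n)} {p : En n → En n} (hp : IsMetricProj K p) {ρ : ℝ}
    {x : En n} : x ∈ pbody K ρ ↔ infDist x K ≤ ρ := by
  constructor
  · rintro ⟨k, hk, b, hb, rfl⟩
    refine (infDist_le_dist_of_mem hk).trans ?_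
    simpa [dist_eq_norm] using hb
  · intro h
    refine ⟨p x, (hp x).1, x - p x, ?_, by simp⟩
    rw [mem_closedBall_zero_iff, ← dist_eq_norm, (hp x).2]
    exact h

lemma shell_eq {n : ℕ} {K : Set (En n)} {p : En n → En n} (hK : IsConvexBody K)
    (hp : IsMetricProj K p) (ρ : ℝ) : shell K ρ = Sh K 0 ρ := by
  ext x
  rw [shell, Set.mem_sdiff, mem_pbody_iff hp, hK.2.1.isClosed.mem_iff_infDist_zero hK.1]
  have : 0 ≤ infDist x K := infDist_nonneg
  constructor
  · rintro ⟨h1, h2⟩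
    exact ⟨lt_of_le_of_ne this (Ne.symm h2), h1⟩
  · rintro ⟨h1, h2⟩
    exact ⟨h2, h1.ne'⟩

lemma BL_cont {n : ℕ} {f : En n × En n → ℝ} (hf : IsBLFun f) : Continuous f := by
  have : LipschitzWith 2 f := by
    refine LipschitzWith.of_dist_le_mul fun a b => ?_
    rw [Real.dist_eq]
    refine (hf.1 a b).trans ?_
    have h1 : ‖a.1 - b.1‖ ≤ dist a b := by rw [← dist_eq_norm, Prod.dist_eq]; exact le_max_left _ _
    have h2 : ‖a.2 - b.2‖ ≤ dist a b := by rw [← dist_eq_norm, Prod.dist_eq]; exact le_max_right _ _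
    have h3 : 0 ≤ dist a b := dist_nonneg
    rw [Real.sqrt_le_left (by positivity)]
    have h4 := pow_le_pow_left₀ (norm_nonneg _) h1 2
    have h5 := pow_le_pow_left₀ (norm_nonneg _) h2 2
    push_cast
    nlinarith
  exact this.continuous

lemma meas_pair {n : ℕ} {K : Set (En n)} {p : En n → En n} (hK : IsConvexBody K)
    (hp : IsMetricProj K p) : Measurable (fun x => (p x, uvec K p x)) := by
  have h1 : Measurable p := (proj_lip hK.2.2 hp).continuous.measurable
  refine h1.prodMk ?_
  unfold uvec
  exact (continuous_infDist_pt K).measurable.inv.smul (measurable_id.sub h1)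

lemma integral_eq {n : ℕ} {K : Set (En n)} {p : En n → En n} (hK : IsConvexBody K)
    (hp : IsMetricProj K p) (ρ : ℝ) {f : En n × En n → ℝ} (hf : IsBLFun f) :
    ∫ a, f a ∂(parMeas K p ρ) =
      ∫ x, (Sh K 0 ρ).indicator (fun x => f (p x, uvec K p x)) x := by
  rw [parMeas, integral_map (meas_pair hK hp).aemeasurable (BL_cont hf).aestronglyMeasurable,
    shell_eq hK hp, integral_indicator (measurableSet_Sh _ _ _)]

lemma vol_body {n : ℕ} {K : Set (En n)} {p : En n → En n}
    (hp : IsMetricProj K p) {R : ℝ} {z : En n} (hz : pbody K 2 ⊆ closedBall z R) {a : ℝ}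
    (ha : a ≤ 2) : volume {x | infDist x K ≤ a} ≤ volume (closedBall (0 : En n) R) := by
  rw [← Measure.addHaar_closedBall_center volume z R]
  refine measure_mono fun x hx => hz ?_
  rw [mem_pbody_iff hp]
  exact le_trans hx ha

lemma integrable_ind {n : ℕ} {K : Set (En n)} {p : En n → En n} (hK : IsConvexBody K)
    (hp : IsMetricProj K p) {R : ℝ} {z : En n} (hz : pbody K 2 ⊆ closedBall z R) {ρ : ℝ}
    (hρ : ρ ≤ 1) {f : En n × En n → ℝ} (hf : IsBLFun f) :
    Integrable ((Sh K 0 ρ).indicator (fun x => f (p x, uvec K p x))) := by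
  rw [integrable_indicator_iff (measurableSet_Sh _ _ _)]
  have hfin : volume (Sh K 0 ρ) ≠ ⊤ := by
    refine ne_top_of_le_ne_top (measure_closedBall_lt_top (x := (0 : En n)) (r := R)).ne
      (le_trans (measure_mono ?_) (vol_body hp hz (a := 1) (by norm_num)))
    rintro x ⟨_, h⟩
    exact h.trans hρ
  refine Measure.integrableOn_of_bounded (M := 1) hfin
    ((BL_cont hf).measurable.comp (meas_pair hK hp)).aestronglyMeasurable ?_
  exact Filter.Eventually.of_forall fun x => by simpa using hf.2 _

lemma bound_pt {n : ℕ} {K L : Set (En n)} {pK pL : En n → En n} (hK : IsConvexBody K)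
    (hL : IsConvexBody L) (hpK : IsMetricProj K pK) (hpL : IsMetricProj L pL) {ρ : ℝ}
    (hρ1 : ρ ≤ 1) {f : En n × En n → ℝ} (hf : IsBLFun f) (x : En n) :
    ‖(Sh K 0 ρ).indicator (fun x => f (pK x, uvec K pK x)) x -
      (Sh L 0 ρ).indicator (fun x => f (pL x, uvec L pL x)) x‖ₑ ≤
    (Sh L ρ (ρ + hausdorffDist K L)).indicator (fun _ => (1 : ENNReal)) x +
    (Sh K 0 (0 + hausdorffDist K L)).indicator (fun _ => (1 : ENNReal)) x +
    (Sh K ρ (ρ + hausdorffDist K L)).indicator (fun _ => (1 : ENNReal)) x +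
    (Sh L 0 (0 + hausdorffDist K L)).indicator (fun _ => (1 : ENNReal)) x +
    (Sh K 0 1).indicator (fun x => ENNReal.ofReal (5 * √(hausdorffDist K L)) *
      ENNReal.ofReal (1 / √(infDist x K))) x := by
  have hd1 := infDist_close hK hL x
  have hd2 := infDist_close hL hK x
  rw [hausdorffDist_comm] at hd2
  have hone : ∀ a, ‖f a‖ₑ ≤ 1 := by
    intro a
    rw [← ofReal_norm, ← ENNReal.ofReal_one]
    exact ENNReal.ofReal_le_ofReal (hf.2 a)
  have n1 : 0 ≤ infDist x K := infDist_nonneg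
  have n2 : 0 ≤ infDist x L := infDist_nonneg
  by_cases hA : x ∈ Sh K 0 ρ <;> by_cases hB : x ∈ Sh L 0 ρ
  · rw [Set.indicator_of_mem hA, Set.indicator_of_mem hB]
    refine le_trans ?_ le_add_self
    rw [Set.indicator_of_mem (show x ∈ Sh K 0 1 from ⟨hA.1, hA.2.trans hρ1⟩),
      ← ENNReal.ofReal_mul (by positivity), ← ofReal_norm]
    exact ENNReal.ofReal_le_ofReal
      (pointwise hK hL hpK hpL hA.1 (hA.2.trans hρ1) hB.1 hf)
  · rw [Set.indicator_of_mem hA, Set.indicator_of_notMem hB, sub_zero]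
    refine (hone _).trans ?_
    rcases le_or_gt (infDist x L) ρ with h | h
    · have h0 : infDist x L ≤ 0 := by
        by_contra! h0
        exact hB ⟨h0, h⟩
      rw [Set.indicator_of_mem (show x ∈ Sh K 0 (0 + hausdorffDist K L) from
        ⟨hA.1, by linarith⟩)]
      exact le_add_right (le_add_right (le_add_right le_add_self))
    · rw [Set.indicator_of_mem (show x ∈ Sh L ρ (ρ + hausdorffDist K L) from
        ⟨h, by linarith [hA.2]⟩)]
      exact le_add_right (le_add_right (le_add_right le_self_add))
  · rw [Set.indicator_of_notMem hA, Set.indicator_of_mem hB, zero_sub, enorm_neg]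
    refine (hone _).trans ?_
    rcases le_or_gt (infDist x K) ρ with h | h
    · have h0 : infDist x K ≤ 0 := by
        by_contra! h0
        exact hA ⟨h0, h⟩
      rw [Set.indicator_of_mem (show x ∈ Sh L 0 (0 + hausdorffDist K L) from
        ⟨hB.1, by linarith⟩)]
      exact le_add_right le_add_self
    · rw [Set.indicator_of_mem (show x ∈ Sh K ρ (ρ + hausdorffDist K L) from
        ⟨h, by linarith [hB.2]⟩)]
      exact le_add_right (le_add_right le_add_self)
  · rw [Set.indicator_of_notMem hA, Set.indicator_of_notMem hB]
    simp

lemma abs_int_le {n : ℕ} {K : Set (En n)} {p : En n → En n} (hK : IsConvexBody K)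
    (hp : IsMetricProj K p) {R : ℝ} {z : En n} (hz : pbody K 2 ⊆ closedBall z R) {ρ : ℝ}
    (hρ : ρ ≤ 1) {f : En n × En n → ℝ} (hf : IsBLFun f) :
    |∫ a, f a ∂(parMeas K p ρ)| ≤ (volume (closedBall (0 : En n) R)).toReal := by
  rw [integral_eq hK hp ρ hf, integral_indicator (measurableSet_Sh _ _ _)]
  have hle : volume (Sh K 0 ρ) ≤ volume (closedBall (0 : En n) R) := by
    refine (le_trans (measure_mono ?_) (vol_body hp hz (a := 1) (by norm_num)))
    rintro x ⟨_, h⟩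
    exact h.trans hρ
  have hfin := (measure_closedBall_lt_top (μ := volume) (x := (0 : En n)) (r := R))
  have := norm_setIntegral_le_of_norm_le_const (C := 1) (hle.trans_lt hfin)
    (fun x (_ : x ∈ Sh K 0 ρ) => show ‖f (p x, uvec K p x)‖ ≤ 1 from hf.2 _)
  rw [one_mul] at this
  exact this.trans (ENNReal.toReal_mono hfin.ne hle)

end ParHolder

open ParHolder in
/-- Hölder estimate for the local parallel volume measures:
`d_bL(μ_{K,ρ}, μ_{L,ρ}) ≤ C(R) d_H(K,L)^{1/2}` for `0 < ρ ≤ 1`. -/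
theorem dbL_parMeas_holder (n : ℕ) (hn : 1 ≤ n) (R : ℝ) (hR : 0 < R) :
    ∃ C : ℝ, 0 < C ∧
      ∀ K L : Set (En n), IsConvexBody K → IsConvexBody L →
        (∃ z : En n, pbody K 2 ⊆ Metric.closedBall z R ∧ pbody L 2 ⊆ Metric.closedBall z R) →
        ∀ pK pL : En n → En n, IsMetricProj K pK → IsMetricProj L pL →
          ∀ ρ : ℝ, 0 < ρ → ρ ≤ 1 →
            ∀ f : En n × En n → ℝ, IsBLFun f →
              |(∫ a, f a ∂(parMeas K pK ρ)) - ∫ a, f a ∂(parMeas L pL ρ)| ≤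
                C * Real.sqrt (Metric.hausdorffDist K L) := by
  set V := volume (closedBall (0 : En n) R) with hVdef
  have hVfin : V ≠ ⊤ := (measure_closedBall_lt_top (μ := volume) (x := (0 : En n)) (r := R)).ne
  have hV0 : 0 ≤ V.toReal := ENNReal.toReal_nonneg
  refine ⟨48 * V.toReal + 1, by positivity, ?_⟩
  rintro K L hK hL ⟨z, hzK, hzL⟩ pK pL hpK hpL ρ hρ hρ1 f hf
  have hδ : 0 ≤ hausdorffDist K L := hausdorffDist_nonneg
  have hs : 0 ≤ √(hausdorffDist K L) := Real.sqrt_nonneg _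
  rcases le_or_gt (hausdorffDist K L) 1 with h1 | h1
  · have hs1 : hausdorffDist K L ≤ √(hausdorffDist K L) := by
      apply Real.le_sqrt_of_sq_le; nlinarith
    have b1 := vol_Sh_le' hL.2.2 hpL hρ.le hδ h1 (vol_body hpL hzL (a := ρ + 1) (by linarith))
    have b2 := vol_Sh_le' hK.2.2 hpK le_rfl hδ h1 (vol_body hpK hzK (a := 0 + 1) (by linarith))
    have b3 := vol_Sh_le' hK.2.2 hpK hρ.le hδ h1 (vol_body hpK hzK (a := ρ + 1) (by linarith))
    have b4 := vol_Sh_le' hL.2.2 hpL le_rfl hδ h1 (vol_body hpL hzL (a := 0 + 1) (by linarith))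
    have b5 := lint_le hK.2.2 hpK (vol_body hpK hzK (a := 1) (by linarith))
    rw [← hVdef] at b1 b2 b3 b4 b5
    rw [integral_eq hK hpK ρ hf, integral_eq hL hpL ρ hf,
      ← integral_sub (integrable_ind hK hpK hzK hρ1 hf) (integrable_ind hL hpL hzL hρ1 hf)]
    have key : ‖∫ x, ((Sh K 0 ρ).indicator (fun x => f (pK x, uvec K pK x)) x -
        (Sh L 0 ρ).indicator (fun x => f (pL x, uvec L pL x)) x)‖ₑ ≤
        ENNReal.ofReal (48 * √(hausdorffDist K L)) * V := by
      refine (enorm_integral_le_lintegral_enorm _).trans ?_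
      refine (lintegral_mono (bound_pt hK hL hpK hpL hρ1 hf)).trans ?_
      have m : ∀ (K : Set (En n)) a b,
          Measurable ((Sh K a b).indicator (fun _ => (1 : ENNReal))) := fun K a b =>
        measurable_const.indicator (measurableSet_Sh _ _ _)
      have mg : Measurable ((Sh K 0 1).indicator (fun x =>
          ENNReal.ofReal (5 * √(hausdorffDist K L)) * ENNReal.ofReal (1 / √(infDist x K)))) := by
        refine Measurable.indicator ?_ (measurableSet_Sh _ _ _)
        exact (measurable_const.div
          (continuous_infDist_pt K).measurable.sqrt).ennreal_ofReal.const_mul _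
      rw [lintegral_add_right _ mg, lintegral_add_right _ (m _ _ _),
        lintegral_add_right _ (m _ _ _), lintegral_add_right _ (m _ _ _)]
      simp only [lintegral_indicator_const (measurableSet_Sh _ _ _), one_mul]
      rw [lintegral_indicator (measurableSet_Sh _ _ _),
        lintegral_const_mul' _ _ ENNReal.ofReal_ne_top]
      calc _ ≤ ENNReal.ofReal (2 * hausdorffDist K L) * V +
            ENNReal.ofReal (2 * hausdorffDist K L) * V +
            ENNReal.ofReal (2 * hausdorffDist K L) * V +
            ENNReal.ofReal (2 * hausdorffDist K L) * V +
            ENNReal.ofReal (5 * √(hausdorffDist K L)) * (ENNReal.ofReal 8 * V) := by gcongr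
        _ = ENNReal.ofReal (8 * hausdorffDist K L + 40 * √(hausdorffDist K L)) * V := by
            rw [← mul_assoc, ← ENNReal.ofReal_mul (by positivity), ← add_mul, ← add_mul,
              ← add_mul, ← add_mul, ← ENNReal.ofReal_add (by positivity) (by positivity),
              ← ENNReal.ofReal_add (by positivity) (by positivity),
              ← ENNReal.ofReal_add (by positivity) (by positivity),
              ← ENNReal.ofReal_add (by positivity) (by positivity)]
            congr 2
            ring
        _ ≤ _ := by
            gcongr
            linarith
    have k2 := ENNReal.toReal_mono (ENNReal.mul_ne_top ENNReal.ofReal_ne_top hVfin) key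
    rw [toReal_enorm, ENNReal.toReal_mul, ENNReal.toReal_ofReal (by positivity),
      Real.norm_eq_abs] at k2
    refine k2.trans ?_
    nlinarith
  · have hs1 : 1 ≤ √(hausdorffDist K L) := Real.one_le_sqrt.2 h1.le
    have a1 := abs_int_le hK hpK hzK hρ1 hf
    have a2 := abs_int_le hL hpL hzL hρ1 hf
    have a3 := abs_sub (∫ a, f a ∂(parMeas K pK ρ)) (∫ a, f a ∂(parMeas L pL ρ))
    rw [← hVdef] at a1 a2
    nlinarith

end
end

section
/- Let K, L be convex bodies in ℝⁿ, let ρ > 0, and let D := diam(K_ρ ∪ L_ρ). Then ∫_{K^ρ ∩ L^ρ} ‖p_K(x) − p_L(x)‖ dx ≤ √(5D) · vol_n(K^ρ ∩ L^ρ) · d_H(K, L)^{1/2}, where vol_n is n-dimensional Lebesgue measure. -/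
open MeasureTheory Metric Set Real Pointwise RealInnerProductSpace

noncomputable section

lemma proj_inner_le {n : ℕ} {K : Set (En n)} (hK : IsConvexBody K) {p : En n → En n}
    (hp : IsMetricProj K p) (x : En n) : ∀ w ∈ K, ⟪x - p x, w - p x⟫ ≤ 0 := by
  refine (norm_eq_iInf_iff_real_inner_le_zero hK.2.2 (hp x).1).1 ?_
  rw [← dist_eq_norm, (hp x).2, Metric.infDist_eq_iInf]
  simp [dist_eq_norm]

lemma exists_near {n : ℕ} {K L : Set (En n)} (hK : IsConvexBody K) (hL : IsConvexBody L)
    {a : En n} (ha : a ∈ K) : ∃ b ∈ L, ‖a - b‖ ≤ hausdorffDist K L := by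
  obtain ⟨b, hb, h⟩ := hL.2.1.exists_infDist_eq_dist hL.1 a
  refine ⟨b, hb, ?_⟩
  rw [← dist_eq_norm, ← h]
  exact infDist_le_hausdorffDist_of_mem ha
    (hausdorffEDist_ne_top_of_nonempty_of_bounded hK.1 hL.1 hK.2.1.isBounded hL.2.1.isBounded)

lemma pbody_compact {n : ℕ} {K : Set (En n)} (hK : IsConvexBody K) (ρ : ℝ) :
    IsCompact (pbody K ρ) := hK.2.1.add (isCompact_closedBall _ _)

lemma subset_pbody {n : ℕ} {K : Set (En n)} {ρ : ℝ} (hρ : 0 < ρ) : K ⊆ pbody K ρ := by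
  intro x hx
  exact ⟨x, hx, 0, by simp [hρ.le], by simp⟩

/-- Estimate for the metric projections (from Lemma 1.8.11 of Schneider's book):
`∫_{K^ρ ∩ L^ρ} ‖p_K - p_L‖ ≤ √(5D) · vol_n(K^ρ ∩ L^ρ) · d_H(K,L)^{1/2}`,
where `D = diam(K_ρ ∪ L_ρ)`. -/
theorem integral_proj_dist_le (n : ℕ) (K L : Set (En n))
    (hK : IsConvexBody K) (hL : IsConvexBody L) (ρ : ℝ) (hρ : 0 < ρ)
    (pK pL : En n → En n) (hpK : IsMetricProj K pK) (hpL : IsMetricProj L pL) :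
    (∫ x in shell K ρ ∩ shell L ρ, ‖pK x - pL x‖) ≤
      Real.sqrt (5 * Metric.diam (pbody K ρ ∪ pbody L ρ)) *
        (volume (shell K ρ ∩ shell L ρ)).toReal *
        Real.sqrt (Metric.hausdorffDist K L) := by
  set D := Metric.diam (pbody K ρ ∪ pbody L ρ) with hD
  set δ := Metric.hausdorffDist K L with hδ
  have hδ0 : 0 ≤ δ := hausdorffDist_nonneg
  have hD0 : 0 ≤ D := diam_nonneg
  have hbd : Bornology.IsBounded (pbody K ρ ∪ pbody L ρ) :=
    ((pbody_compact hK ρ).union (pbody_compact hL ρ)).isBounded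
  have hfin : volume (shell K ρ ∩ shell L ρ) < ⊤ :=
    (measure_mono (fun x hx => hx.1.1)).trans_lt (pbody_compact hK ρ).measure_lt_top
  have key : ∀ x ∈ shell K ρ ∩ shell L ρ, ‖‖pK x - pL x‖‖ ≤ √(5 * D) * √δ := by
    intro x hx
    rw [norm_norm, ← Real.sqrt_mul (by positivity)]
    apply Real.le_sqrt_of_sq_le
    obtain ⟨b', hb', hbb⟩ := exists_near hL hK (hpL x).1
    obtain ⟨a', ha', haa⟩ := exists_near hK hL (hpK x).1
    rw [hausdorffDist_comm] at hbb
    have h1 := proj_inner_le hK hpK x b' hb'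
    have h2 := proj_inner_le hL hpL x a' ha'
    have hxa : ‖x - pK x‖ ≤ D := by
      rw [← dist_eq_norm]
      exact dist_le_diam_of_mem hbd (Or.inl hx.1.1) (Or.inl (subset_pbody hρ (hpK x).1))
    have hxb : ‖x - pL x‖ ≤ D := by
      rw [← dist_eq_norm]
      exact dist_le_diam_of_mem hbd (Or.inl hx.1.1) (Or.inr (subset_pbody hρ (hpL x).1))
    have h3 : ⟪x - pL x, pK x - a'⟫ ≤ D * δ :=
      (real_inner_le_norm _ _).trans (mul_le_mul hxb haa (norm_nonneg _) hD0)
    have h4 : ⟪x - pK x, pL x - b'⟫ ≤ D * δ :=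
      (real_inner_le_norm _ _).trans (mul_le_mul hxa hbb (norm_nonneg _) hD0)
    have e : ‖pK x - pL x‖ ^ 2 = ⟪x - pL x, pK x - a'⟫ + ⟪x - pL x, a' - pL x⟫
        + (⟪x - pK x, pL x - b'⟫ + ⟪x - pK x, b' - pK x⟫) := by
      rw [← inner_add_right, ← inner_add_right, ← real_inner_self_eq_norm_sq]
      simp only [sub_add_sub_cancel]
      rw [← neg_sub (pK x) (pL x), inner_neg_right, ← sub_eq_add_neg, ← inner_sub_left]
      simp
    have : 0 ≤ D * δ := by positivity
    rw [e]; linarith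
  have := norm_setIntegral_le_of_norm_le_const hfin key
  refine (le_abs_self _).trans (this.trans (le_of_eq ?_))
  rw [Measure.real]; ring

end
end

section
/- Let K, L be convex bodies in ℝⁿ with d_H(K, L) ≤ δ, and let y ∈ ℝⁿ be a point with dist(y, K) = t, where t > δ. Then dist(y, L) > 0, and the unit normal directions satisfy ‖u_K(y) − u_L(y)‖ ≤ 2·√(δ / (t + δ)). -/
open MeasureTheory Metric Set Real Pointwise RealInnerProductSpace

noncomputable section

/-- If `d_H(K,L) ≤ δ` and `dist(y,K) = t > δ`, then `dist(y,L) > 0` and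
`‖u_K(y) - u_L(y)‖ ≤ 2 √(δ/(t+δ))`. -/
theorem normal_vectors_dist_le (n : ℕ) (K L : Set (En n))
    (hK : IsConvexBody K) (hL : IsConvexBody L) (δ t : ℝ)
    (hδ : Metric.hausdorffDist K L ≤ δ) (y : En n)
    (ht : Metric.infDist y K = t) (htδ : δ < t)
    (pK pL : En n → En n) (hpK : IsMetricProj K pK) (hpL : IsMetricProj L pL) :
    0 < Metric.infDist y L ∧
      ‖uvec K pK y - uvec L pL y‖ ≤ 2 * Real.sqrt (δ / (t + δ)) := by
  obtain ⟨hKne, hKc, hKconv⟩ := hK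
  obtain ⟨hLne, hLc, hLconv⟩ := hL
  have hfin : Metric.hausdorffEDist K L ≠ ⊤ :=
    Metric.hausdorffEDist_ne_top_of_nonempty_of_bounded hKne hLne hKc.isBounded hLc.isBounded
  have hfin' : Metric.hausdorffEDist L K ≠ ⊤ := by
    rwa [Metric.hausdorffEDist_comm]
  have hδ' : Metric.hausdorffDist L K ≤ δ := by
    rwa [Metric.hausdorffDist_comm]
  have h1 := Metric.infDist_le_infDist_add_hausdorffDist (x := y) hfin
  have h2 := Metric.infDist_le_infDist_add_hausdorffDist (x := y) hfin'
  have hδ0 : 0 ≤ δ := le_trans Metric.hausdorffDist_nonneg hδ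
  obtain ⟨hpKm, hpKd⟩ := hpK y
  obtain ⟨hpLm, hpLd⟩ := hpL y
  -- a point of K near pL y
  obtain ⟨q, hqK, hq⟩ := hKc.exists_infDist_eq_dist hKne (pL y)
  have hqd : dist (pL y) q ≤ δ := by
    rw [← hq]
    exact (Metric.infDist_le_hausdorffDist_of_mem hpLm hfin').trans hδ'
  have hvar : inner ℝ (y - pK y) (q - pK y) ≤ 0 := by
    refine (norm_eq_iInf_iff_real_inner_le_zero hKconv hpKm).1 ?_ q hqK
    rw [← dist_eq_norm, hpKd, Metric.infDist_eq_iInf]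
    simp only [dist_eq_norm]
  unfold uvec
  rw [dist_eq_norm] at hpKd hpLd hqd
  rw [ht] at hpKd h1 h2 ⊢
  generalize Metric.infDist y L = s at *
  have hs : 0 < s := by linarith
  have ht0 : 0 < t := by linarith
  refine ⟨hs, ?_⟩
  have hcs : inner ℝ (y - pK y) (pL y - q) ≤ t * δ := by
    have := abs_real_inner_le_norm (y - pK y) (pL y - q)
    rw [hpKd] at this
    have h3 := (abs_le.1 this).2
    nlinarith
  have hdec : inner ℝ (y - pK y) (q - pK y) = t ^ 2 - inner ℝ (y - pK y) (y - pL y)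
      - inner ℝ (y - pK y) (pL y - q) := by
    rw [← hpKd, ← real_inner_self_eq_norm_sq, ← inner_sub_right, ← inner_sub_right]
    congr 1
    abel
  have hab : t ^ 2 - t * δ ≤ inner ℝ (y - pK y) (y - pL y) := by linarith
  have huv : (t - δ) / (t + δ) ≤ t⁻¹ * (s⁻¹ * inner ℝ (y - pK y) (y - pL y)) := by
    have e : t⁻¹ * (s⁻¹ * inner ℝ (y - pK y) (y - pL y))
        = inner ℝ (y - pK y) (y - pL y) / (t * s) := by
      field_simp
    rw [e, div_le_div_iff₀ (by linarith) (by positivity)]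
    have hst : s ≤ t + δ := by linarith
    have h5 : (t - δ) * (t * s) ≤ (t - δ) * (t * (t + δ)) := by
      gcongr
    nlinarith
  have hn : ‖t⁻¹ • (y - pK y) - s⁻¹ • (y - pL y)‖ ^ 2 ≤ 4 * (δ / (t + δ)) := by
    rw [norm_sub_sq_real, norm_smul, norm_smul, hpKd, hpLd, real_inner_smul_left,
      real_inner_smul_right, norm_inv, norm_inv, Real.norm_of_nonneg hs.le,
      Real.norm_of_nonneg ht0.le, inv_mul_cancel₀ hs.ne', inv_mul_cancel₀ ht0.ne']
    have e : (t - δ) / (t + δ) = 1 - 2 * (δ / (t + δ)) := by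
      have : t + δ ≠ 0 := by linarith
      field_simp
      ring
    linarith
  have hd : 0 ≤ δ / (t + δ) := by positivity
  refine abs_le_of_sq_le_sq' ?_ (by positivity) |>.2
  rw [mul_pow, Real.sq_sqrt hd]
  linarith


end
end

section
/- Let n ≥ 1 and R > 0. There exists a constant C > 0, depending only on n and R, such that for all convex bodies K, L in ℝⁿ with K + 2Bⁿ and L + 2Bⁿ contained in a closed ball of radius R, with d_H(K, L) ≤ 1, and for every ρ with 0 < ρ ≤ 1, one has ∫_{K^ρ ∩ L^ρ} ‖u_K(x) − u_L(x)‖ dx ≤ C · d_H(K, L)^{1/2}. -/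
open MeasureTheory Metric Set Real Pointwise RealInnerProductSpace

noncomputable section

theorem aux_subgrad {n : ℕ} {K : Set (En n)} (hK : IsConvexBody K) {p : En n → En n}
    (hp : IsMetricProj K p) (x y : En n) :
    infDist x K + ⟪uvec K p x, y - x⟫ ≤ infDist y K := by
  have hne : K.Nonempty := hK.1
  have hd : ‖x - p x‖ = infDist x K := by rw [← dist_eq_norm]; exact (hp x).2
  rcases eq_or_ne (infDist x K) 0 with h0 | h0
  · simp [uvec, h0, infDist_nonneg]
  have hpos : 0 < infDist x K := lt_of_le_of_ne infDist_nonneg (Ne.symm h0)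
  have hin : ⟪x - p x, p y - p x⟫ ≤ 0 := by
    refine (norm_eq_iInf_iff_real_inner_le_zero hK.2.2 (hp x).1).1 ?_ (p y) (hp y).1
    rw [hd, infDist_eq_iInf]
    simp [dist_eq_norm]
  have hcs : ⟪x - p x, y - p y⟫ ≤ infDist x K * infDist y K := by
    have := real_inner_le_norm (x - p x) (y - p y)
    rwa [hd, ← dist_eq_norm y, (hp y).2] at this
  have hself : ⟪x - p x, x - p x⟫ = infDist x K * infDist x K := by
    rw [real_inner_self_eq_norm_mul_norm, hd]
  have hdec : ⟪x - p x, y - x⟫ = ⟪x - p x, y - p y⟫ + ⟪x - p x, p y - p x⟫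
      - ⟪x - p x, x - p x⟫ := by
    rw [← inner_add_right, ← inner_sub_right]; congr 1; abel
  have hle : ⟪x - p x, y - x⟫ ≤ infDist x K * (infDist y K - infDist x K) := by
    rw [hdec, hself]; linarith
  have : ⟪uvec K p x, y - x⟫ ≤ infDist y K - infDist x K := by
    rw [uvec, real_inner_smul_left, inv_mul_le_iff₀ hpos]; exact hle
  linarith

theorem aux_point {n : ℕ} {K L : Set (En n)} (hK : IsConvexBody K) (hL : IsConvexBody L)
    {pK pL : En n → En n} (hpK : IsMetricProj K pK) (hpL : IsMetricProj L pL)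
    (x e : En n) {h : ℝ} (hh : 0 < h) :
    |⟪uvec K pK x - uvec L pL x, e⟫| ≤
      (infDist (x + h • e) L + infDist (x - h • e) L - 2 * infDist x L
        + 2 * hausdorffDist K L) / h := by
  have fin : hausdorffEDist K L ≠ ⊤ :=
    hausdorffEDist_ne_top_of_nonempty_of_bounded hK.1 hL.1 hK.2.1.isBounded hL.2.1.isBounded
  have fin' : hausdorffEDist L K ≠ ⊤ := by rwa [hausdorffEDist_comm]
  have a1 : ∀ y, infDist y K ≤ infDist y L + hausdorffDist K L := fun y => by
    rw [hausdorffDist_comm]; exact infDist_le_infDist_add_hausdorffDist fin'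
  have a2 : ∀ y, infDist y L ≤ infDist y K + hausdorffDist K L := fun y =>
    infDist_le_infDist_add_hausdorffDist fin
  have b1 := aux_subgrad hK hpK x (x + h • e)
  have b2 := aux_subgrad hK hpK x (x - h • e)
  have b3 := aux_subgrad hL hpL x (x + h • e)
  have b4 := aux_subgrad hL hpL x (x - h • e)
  have e1 : x + h • e - x = h • e := by abel
  have e2 : x - h • e - x = -(h • e) := by abel
  rw [e1, inner_smul_right] at b1 b3
  rw [e2, inner_neg_right, inner_smul_right] at b2 b4
  have c1 := a1 (x + h • e)
  have c2 := a1 (x - h • e)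
  have c3 := a2 x
  rw [le_div_iff₀ hh, inner_sub_left, ← abs_of_pos hh, ← abs_mul, abs_of_pos hh, abs_le]
  constructor <;> nlinarith

theorem aux_norm {n : ℕ} (v : En n) :
    ‖v‖ ≤ ∑ i : Fin n, |⟪v, EuclideanSpace.single i (1 : ℝ)⟫| := by
  calc ‖v‖ = ‖∑ i : Fin n, (v i) • (EuclideanSpace.single i (1 : ℝ) : En n)‖ := by
        congr 1
        ext j
        simp [Pi.single_apply]
    _ ≤ ∑ i : Fin n, ‖(v i) • (EuclideanSpace.single i (1 : ℝ) : En n)‖ := norm_sum_le _ _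
    _ = _ := by
        refine Finset.sum_congr rfl fun i _ => ?_
        simp [norm_smul, EuclideanSpace.inner_single_right]

def aeta {n : ℕ} (z : En n) (R : ℝ) (x : En n) : ℝ := max 0 (R + 1 - dist x z)

theorem aeta_cont {n : ℕ} (z : En n) (R : ℝ) : Continuous (aeta z R) := by
  unfold aeta; fun_prop

theorem aeta_lip {n : ℕ} (z : En n) (R : ℝ) (x y : En n) :
    aeta z R x - aeta z R y ≤ dist x y := by
  unfold aeta
  have := dist_triangle_left y z x
  have h0 : 0 ≤ dist x y := dist_nonneg
  rw [sub_le_iff_le_add]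
  apply max_le
  · have := le_max_left 0 (R + 1 - dist y z); linarith
  · have := le_max_right 0 (R + 1 - dist y z); linarith

theorem aeta_supp {n : ℕ} (z : En n) (R : ℝ) (x : En n) (hx : x ∉ closedBall z (R + 1)) :
    aeta z R x = 0 := by
  rw [mem_closedBall, not_le] at hx
  exact max_eq_left (by linarith)

theorem aeta_cs {n : ℕ} (z : En n) (R : ℝ) : HasCompactSupport (aeta z R) :=
  HasCompactSupport.intro (isCompact_closedBall z (R + 1)) fun x hx => aeta_supp z R x hx

theorem aeta_int {n : ℕ} (z : En n) (R : ℝ) {f : En n → ℝ} (hf : Continuous f) :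
    Integrable (fun x => aeta z R x * f x) :=
  ((aeta_cont z R).mul hf).integrable_of_hasCompactSupport (aeta_cs z R).mul_right

theorem aux_vol {n : ℕ} (z : En n) (r c : ℝ) {f : En n → ℝ} 
    (h1 : ∀ x ∈ closedBall z r, f x ≤ c) (h2 : ∀ x ∉ closedBall z r, f x = 0)
    (hf : Integrable f) :
    ∫ x, f x ≤ c * (volume (closedBall (0 : En n) r)).toReal := by
  have hi : Integrable ((closedBall z r).indicator fun _ => c) := by
    rw [integrable_indicator_iff measurableSet_closedBall]
    exact integrableOn_const (isCompact_closedBall z r).measure_lt_top.ne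
  have : ∫ x, f x ≤ ∫ x, (closedBall z r).indicator (fun _ => c) x := by
    refine integral_mono hf hi fun x => ?_
    by_cases hx : x ∈ closedBall z r
    · simp only [indicator_of_mem hx]; exact h1 x hx
    · simp only [indicator_of_notMem hx]; exact (h2 x hx).le
  refine this.trans (le_of_eq ?_)
  rw [integral_indicator measurableSet_closedBall, setIntegral_const, Measure.real,
    Measure.addHaar_closedBall_center, smul_eq_mul, mul_comm]

theorem aux_second {n : ℕ} (z : En n) {R : ℝ} (L : Set (En n)) (e : En n)
    (he : ‖e‖ = 1) {h : ℝ} (hh : 0 < h) (h1 : h ≤ 1) :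
    ∫ x, aeta z R x * (infDist (x + h • e) L + infDist (x - h • e) L - 2 * infDist x L)
      ≤ h ^ 2 * (volume (closedBall (0 : En n) (R + 2))).toReal := by
  have hgc : Continuous fun x : En n => infDist x L := continuous_infDist_pt L
  have hc1 : Continuous fun x : En n => infDist (x + h • e) L - infDist x L := by fun_prop
  have hc2 : Continuous fun x : En n => infDist x L - infDist (x - h • e) L := by fun_prop
  have hnorm : ‖h • e‖ = h := by rw [norm_smul, he, Real.norm_eq_abs, abs_of_pos hh, mul_one]
  have i1 := aeta_int z R hc1
  have i2 := aeta_int z R hc2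
  have i3 : Integrable fun x => aeta z R (x + h • e) * (infDist (x + h • e) L - infDist x L) := by
    have := i2.comp_add_right (h • e)
    simpa using this
  have e3 : ∫ x, aeta z R x * (infDist x L - infDist (x - h • e) L)
      = ∫ x, aeta z R (x + h • e) * (infDist (x + h • e) L - infDist x L) := by
    rw [← integral_add_right_eq_self _ (h • e)]
    simp
  have e4 : ∫ x, aeta z R x * (infDist (x + h • e) L + infDist (x - h • e) L - 2 * infDist x L)
      = ∫ x, (aeta z R x - aeta z R (x + h • e)) * (infDist (x + h • e) L - infDist x L) := by
    simp_rw [sub_mul]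
    rw [integral_sub i1 i3, ← e3, ← integral_sub i1 i2]
    congr 1; ext x; ring
  rw [e4]
  refine aux_vol z (R + 2) (h ^ 2) ?_ ?_ ?_
  · intro x _
    have d1 : dist (x + h • e) x = h := by rw [dist_eq_norm]; simpa using hnorm
    have p1 := aeta_lip z R x (x + h • e)
    have p2 := aeta_lip z R (x + h • e) x
    have q1 := infDist_le_infDist_add_dist (s := L) (x := x) (y := x + h • e)
    have q2 := infDist_le_infDist_add_dist (s := L) (x := x + h • e) (y := x)
    rw [dist_comm, d1] at p1 q1
    rw [d1] at p2 q2
    refine (le_abs_self _).trans ?_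
    rw [abs_mul, pow_two]
    refine mul_le_mul ?_ ?_ (abs_nonneg _) hh.le <;> rw [abs_le] <;> constructor <;> linarith
  · intro x hx
    rw [mem_closedBall, not_le] at hx
    rw [aeta_supp z R x, aeta_supp z R (x + h • e)]
    · simp
    · rw [mem_closedBall, not_le]
      have d1 : dist x (x + h • e) = h := by rw [dist_comm, dist_eq_norm]; simpa using hnorm
      have := dist_triangle x (x + h • e) z
      linarith
    · rw [mem_closedBall, not_le]; linarith
  · simp_rw [sub_mul]; exact i1.sub i3

theorem aux_main {n : ℕ} {R : ℝ} (hR : 0 < R) {K L A : Set (En n)}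
    (hK : IsConvexBody K) (hL : IsConvexBody L)
    {pK pL : En n → En n} (hpK : IsMetricProj K pK) (hpL : IsMetricProj L pL)
    (z : En n) (hA : A ⊆ closedBall z R) (hAm : MeasurableSet A)
    {h : ℝ} (hh : 0 < h) (h1 : h ≤ 1) :
    ∫ x in A, ‖uvec K pK x - uvec L pL x‖ ≤
      n * (volume (closedBall (0 : En n) (R + 2))).toReal *
        (h + 2 * (R + 1) * (hausdorffDist K L / h)) := by
  set δ := hausdorffDist K L with hδ
  have hδ0 : 0 ≤ δ := hausdorffDist_nonneg
  set V := (volume (closedBall (0 : En n) (R + 2))).toReal with hV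
  let E : Fin n → En n := fun i => EuclideanSpace.single i (1 : ℝ)
  let D : Fin n → En n → ℝ := fun i x =>
    infDist (x + h • E i) L + infDist (x - h • E i) L - 2 * infDist x L
  have hDc : ∀ i, Continuous (D i) := fun i => by
    have hgc : Continuous fun x : En n => infDist x L := continuous_infDist_pt L
    simp only [D]; fun_prop
  have hpt : ∀ x i, |⟪uvec K pK x - uvec L pL x, E i⟫| ≤ (D i x + 2 * δ) / h :=
    fun x i => aux_point hK hL hpK hpL x (E i) hh
  have hnn : ∀ x i, 0 ≤ (D i x + 2 * δ) / h := fun x i => (abs_nonneg _).trans (hpt x i)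
  have hη0 : ∀ x, 0 ≤ aeta z R x := fun x => le_max_left _ _
  have hint : ∀ i, Integrable fun x => aeta z R x * ((D i x + 2 * δ) / h) := fun i =>
    aeta_int z R (by have := hDc i; fun_prop)
  have hints : Integrable fun x => ∑ i, aeta z R x * ((D i x + 2 * δ) / h) :=
    integrable_finsetSum _ fun i _ => hint i
  have s1 : ∫ x in A, ‖uvec K pK x - uvec L pL x‖ ≤
      ∫ x in A, ∑ i, aeta z R x * ((D i x + 2 * δ) / h) := by
    refine integral_mono_of_nonneg (Filter.Eventually.of_forall fun x => norm_nonneg _)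
      hints.integrableOn ?_
    refine (ae_restrict_mem hAm).mono fun x hx => ?_
    have hη1 : 1 ≤ aeta z R x := by
      have := hA hx
      rw [mem_closedBall] at this
      exact le_max_of_le_right (by linarith)
    refine (aux_norm _).trans (Finset.sum_le_sum fun i _ => (hpt x i).trans ?_)
    exact le_mul_of_one_le_left (hnn x i) hη1
  have s2 : ∫ x in A, ∑ i, aeta z R x * ((D i x + 2 * δ) / h) ≤
      ∫ x, ∑ i, aeta z R x * ((D i x + 2 * δ) / h) :=
    setIntegral_le_integral hints (Filter.Eventually.of_forall fun x =>
      Finset.sum_nonneg fun i _ => mul_nonneg (hη0 x) (hnn x i))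
  have s3 : ∀ i, ∫ x, aeta z R x * ((D i x + 2 * δ) / h) ≤
      V * (h + 2 * (R + 1) * (δ / h)) := by
    intro i
    have t1 : ∫ x, aeta z R x * D i x ≤ h ^ 2 * V :=
      aux_second z L (E i) (by simp [E]) hh h1
    have t2 : ∫ x, aeta z R x * (2 * δ) ≤ ((R + 1) * (2 * δ)) * V := by
      refine aux_vol z (R + 2) _ ?_ ?_ (aeta_int z R continuous_const)
      · intro x _
        refine mul_le_mul_of_nonneg_right ?_ (by linarith)
        have : 0 ≤ dist x z := dist_nonneg
        exact max_le (by linarith) (by linarith)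
      · intro x hx
        rw [aeta_supp z R x, zero_mul]
        rw [mem_closedBall, not_le] at hx ⊢; linarith
    have t3 : ∫ x, aeta z R x * ((D i x + 2 * δ) / h) =
        ((∫ x, aeta z R x * D i x) + ∫ x, aeta z R x * (2 * δ)) / h := by
      rw [← integral_add (aeta_int z R (hDc i)) (aeta_int z R continuous_const),
        ← integral_div]
      congr 1; ext x; ring
    rw [t3, div_le_iff₀ hh]
    have : V * (h + 2 * (R + 1) * (δ / h)) * h = h ^ 2 * V + (R + 1) * (2 * δ) * V := by
      field_simp
    linarith
  refine s1.trans (s2.trans ?_)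
  rw [integral_finsetSum _ fun i _ => hint i]
  refine (Finset.sum_le_sum fun i _ => s3 i).trans (le_of_eq ?_)
  simp [mul_assoc]

/-- Estimate for the normal vectors:
`∫_{K^ρ ∩ L^ρ} ‖u_K - u_L‖ ≤ C(R) d_H(K,L)^{1/2}` for `0 < ρ ≤ 1` and `d_H(K,L) ≤ 1`. -/
theorem integral_normal_dist_le (n : ℕ) (hn : 1 ≤ n) (R : ℝ) (hR : 0 < R) :
    ∃ C : ℝ, 0 < C ∧
      ∀ K L : Set (En n), IsConvexBody K → IsConvexBody L →
        (∃ z : En n, pbody K 2 ⊆ Metric.closedBall z R ∧ pbody L 2 ⊆ Metric.closedBall z R) →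
        Metric.hausdorffDist K L ≤ 1 →
        ∀ pK pL : En n → En n, IsMetricProj K pK → IsMetricProj L pL →
          ∀ ρ : ℝ, 0 < ρ → ρ ≤ 1 →
            (∫ x in shell K ρ ∩ shell L ρ, ‖uvec K pK x - uvec L pL x‖) ≤
              C * Real.sqrt (Metric.hausdorffDist K L) := by
  set V := (volume (closedBall (0 : En n) (R + 2))).toReal with hV
  have hV0 : 0 ≤ V := ENNReal.toReal_nonneg
  refine ⟨n * V * (1 + 2 * (R + 1)) + 1, by positivity, ?_⟩
  rintro K L hK hL ⟨z, hz, -⟩ hd pK pL hpK hpL ρ hρ hρ1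
  have hpm : ∀ M : Set (En n), IsConvexBody M → MeasurableSet (shell M ρ) := fun M hM =>
    (hM.2.1.add (isCompact_closedBall 0 ρ)).measurableSet.diff hM.2.1.measurableSet
  have hA : shell K ρ ∩ shell L ρ ⊆ closedBall z R := by
    rintro x ⟨⟨hx, -⟩, -⟩
    exact hz (Set.add_subset_add_left (closedBall_subset_closedBall (by linarith)) hx)
  have key := fun (h : ℝ) (hh : 0 < h) (h1 : h ≤ 1) =>
    aux_main hR hK hL hpK hpL z hA ((hpm K hK).inter (hpm L hL)) hh h1
  rw [← hV] at key
  have hδ0 : 0 ≤ hausdorffDist K L := hausdorffDist_nonneg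
  set δ := hausdorffDist K L with hδ
  rcases hδ0.eq_or_lt with h0 | h0
  · rw [← h0]
    rw [← h0] at key
    simp only [zero_div, mul_zero, add_zero, Real.sqrt_zero] at key ⊢
    refine le_of_forall_pos_le_add fun ε hε => ?_
    have hc : 0 < n * V + 1 := by positivity
    have hm : 0 < min 1 (ε / (n * V + 1)) := by positivity
    refine (key _ hm (min_le_left _ _)).trans ?_
    have h2 : n * V * min 1 (ε / (n * V + 1)) ≤ (n * V + 1) * (ε / (n * V + 1)) :=
      mul_le_mul (by linarith) (min_le_right _ _) hm.le hc.le
    rw [mul_div_cancel₀ _ hc.ne'] at h2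
    linarith
  · have hs : 0 < Real.sqrt δ := Real.sqrt_pos.2 h0
    have := key (Real.sqrt δ) hs (Real.sqrt_le_one.2 hd)
    rw [Real.div_sqrt] at this
    refine this.trans ?_
    nlinarith

end
end

section
/- Let n ≥ 1 and R > 0. There exists a constant C > 0, depending only on n and R, such that for all convex bodies K, L in ℝⁿ contained in a closed ball of radius R with d_H(K, L) ≤ 1, and for every ρ with 0 < ρ ≤ 1, the n-dimensional Lebesgue measure of the symmetric difference satisfies vol_n(K^ρ △ L^ρ) ≤ C · d_H(K, L). -/
open MeasureTheory Metric Set Real Pointwise RealInnerProductSpace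

noncomputable section

lemma aux_proj {n : ℕ} {M : Set (En n)} (hM : IsConvexBody M) (y : En n) :
    ∃ p ν : En n, p ∈ M ∧ ‖ν‖ ≤ 1 ∧ inner ℝ ν (y - p) = ‖y - p‖ ∧
      (∀ w ∈ M, inner ℝ ν (w - p) ≤ 0) ∧ (∀ w ∈ M, ‖y - p‖ ≤ ‖y - w‖) ∧
      (y ∉ M → inner ℝ ν ν = (1 : ℝ) ∧ 0 < ‖y - p‖) := by
  obtain ⟨hne, hc, hconv⟩ := hM
  obtain ⟨p, hp, hpe⟩ := exists_norm_eq_iInf_of_complete_convex hne hc.isComplete hconv y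
  have hin := (norm_eq_iInf_iff_real_inner_le_zero hconv hp).1 hpe
  refine ⟨p, ‖y - p‖⁻¹ • (y - p), hp, ?_, ?_, ?_, ?_, ?_⟩
  · rw [norm_smul, norm_inv, norm_norm]
    exact inv_mul_le_one
  · rw [real_inner_smul_left, real_inner_self_eq_norm_sq]
    by_cases h : ‖y - p‖ = 0
    · simp [h]
    · field_simp
  · intro w hw
    rw [real_inner_smul_left]
    exact mul_nonpos_of_nonneg_of_nonpos (by positivity) (hin w hw)
  · intro w hw
    rw [hpe]
    exact ciInf_le ⟨0, Set.forall_mem_range.2 fun _ => norm_nonneg _⟩ (⟨w, hw⟩ : M)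
  · intro hy
    have h : 0 < ‖y - p‖ := by
      rw [norm_pos_iff, sub_ne_zero]
      rintro rfl
      exact hy hp
    refine ⟨?_, h⟩
    rw [real_inner_smul_left, real_inner_smul_right, real_inner_self_eq_norm_sq]
    field_simp

lemma aux_mem_pbody {n : ℕ} {M : Set (En n)} {r : ℝ} {x : En n} :
    x ∈ pbody M r ↔ ∃ m ∈ M, ‖x - m‖ ≤ r := by
  unfold pbody
  rw [Set.mem_add]
  constructor
  · rintro ⟨m, hm, b, hb, rfl⟩
    exact ⟨m, hm, by simpa using hb⟩
  · rintro ⟨m, hm, h⟩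
    exact ⟨m, hm, x - m, by simpa using h, by simp⟩

lemma aux_body {n : ℕ} {M : Set (En n)} (hM : IsConvexBody M) {r : ℝ} (hr : 0 ≤ r) :
    IsConvexBody (pbody M r) := by
  refine ⟨?_, ?_, ?_⟩
  · exact hM.1.add ⟨0, by simpa using hr⟩
  · exact hM.2.1.add (isCompact_closedBall _ _)
  · exact hM.2.2.add (convex_closedBall _ _)

lemma aux_volume_le {n : ℕ} {G : En n → En n} (hG : AntilipschitzWith 1 G) (S : Set (En n)) :
    volume S ≤ volume (G '' S) := by
  have h := Measure.isAddLeftInvariant_eq_smul (volume : Measure (En n))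
    (Measure.hausdorffMeasure (Module.finrank ℝ (En n) : ℝ))
  rw [h, Measure.smul_apply, Measure.smul_apply]
  have := hG.le_hausdorffMeasure_image (d := (Module.finrank ℝ (En n) : ℝ)) (by positivity) S
  simp only [ENNReal.coe_one, ENNReal.one_rpow, one_mul] at this
  gcongr

lemma aux_pow (n : ℕ) {e : ℝ} (h0 : 0 ≤ e) (h1 : e ≤ 1) :
    (1 + e) ^ n ≤ 1 + (2 ^ n - 1) * e := by
  induction n with
  | zero => simp
  | succ k ih =>
    have h2 : (1 : ℝ) ≤ 2 ^ k := one_le_pow₀ (by norm_num)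
    rw [pow_succ, pow_succ]
    nlinarith [mul_nonneg (sub_nonneg.2 h2) (mul_nonneg h0 (sub_nonneg.2 h1)),
      mul_le_mul_of_nonneg_right ih (by linarith : 0 ≤ 1 + e)]

lemma aux_shell {n : ℕ} {M : Set (En n)} (hM : IsConvexBody M) {e : ℝ} (h0 : 0 ≤ e) :
    volume (pbody M e \ M) ≤ volume (pbody M (1 + e) \ pbody M 1) := by
  choose p ν hp hν hd hw hmin hout using aux_proj hM
  have key : ∀ y y', inner ℝ (ν y) (y' - y) ≤ ‖y' - p y'‖ - ‖y - p y‖ := by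
    intro y y'
    have e1 : y' - y = (y' - p y') + (p y' - p y) - (y - p y) := by abel
    rw [e1, inner_sub_right, inner_add_right, hd]
    have := hw y _ (hp y')
    have h2 := real_inner_le_norm (ν y) (y' - p y')
    have h3 : ‖ν y‖ * ‖y' - p y'‖ ≤ 1 * ‖y' - p y'‖ := by
      gcongr; exact hν y
    linarith
  have hG : AntilipschitzWith 1 (fun y => y + ν y) := by
    apply AntilipschitzWith.of_le_mul_dist
    intro x y
    simp only [NNReal.coe_one, one_mul, dist_eq_norm]
    have h1 := key x y
    have h2 := key y x
    have h3 : 0 ≤ inner ℝ (ν x - ν y) (x - y) := by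
      rw [inner_sub_left]
      rw [← neg_sub x y, inner_neg_right] at h1
      linarith
    have h4 : x + ν x - (y + ν y) = (x - y) + (ν x - ν y) := by abel
    rw [h4]
    have h5 := norm_add_sq_real (x - y) (ν x - ν y)
    rw [real_inner_comm] at h5
    refine le_of_sq_le_sq ?_ (norm_nonneg _)
    nlinarith [sq_nonneg ‖ν x - ν y‖]
  refine (aux_volume_le hG _).trans (measure_mono ?_)
  rintro _ ⟨y, ⟨hy1, hy2⟩, rfl⟩
  obtain ⟨hn1, hpos⟩ := hout y hy2
  constructor
  · rw [aux_mem_pbody] at hy1 ⊢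
    obtain ⟨m, hm, hme⟩ := hy1
    refine ⟨p y, hp y, ?_⟩
    have h4 : y + ν y - p y = ν y + (y - p y) := by abel
    simp only [h4]
    have := norm_add_le (ν y) (y - p y)
    linarith [hmin y m hm, hν y]
  · rw [aux_mem_pbody]
    rintro ⟨m, hm, hme⟩
    have h4 : y + ν y - m = (y - p y) + ν y - (m - p y) := by abel
    simp only [h4] at hme
    have h2 := real_inner_le_norm (ν y) ((y - p y) + ν y - (m - p y))
    rw [inner_sub_right, inner_add_right, hd, hn1] at h2
    have h3 := hw y m hm
    have h5 : ‖ν y‖ * ‖(y - p y) + ν y - (m - p y)‖ ≤ 1 * 1 := by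
      gcongr; exact hν y
    linarith

lemma aux_main_s7 {n : ℕ} {M : Set (En n)} (hM : IsConvexBody M) {e : ℝ} (h0 : 0 ≤ e)
    (h1 : e ≤ 1) {z : En n} {r : ℝ} (hz : M ⊆ closedBall z r) :
    volume (pbody M e \ M) ≤ ENNReal.ofReal
      (2 ^ n * e * (volume (closedBall (0 : En n) (r + 1))).toReal) := by
  refine (aux_shell hM h0).trans ?_
  obtain ⟨o, ho⟩ := hM.1
  have hb1 := aux_body hM (zero_le_one)
  have hfin : volume (pbody M 1) ≠ ⊤ := hb1.2.1.measure_lt_top.ne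
  have hsub : pbody M (1 + e) ⊆ AffineMap.homothety o (1 + e) '' pbody M 1 := by
    intro x hx
    rw [aux_mem_pbody] at hx
    obtain ⟨m, hm, hxm⟩ := hx
    have hpos : 0 < 1 + e := by linarith
    refine ⟨o + (1 + e)⁻¹ • (x - o), ?_, ?_⟩
    · rw [aux_mem_pbody]
      refine ⟨o + (1 + e)⁻¹ • (m - o), ?_, ?_⟩
      · exact hM.2.2.add_smul_sub_mem ho hm
          ⟨by positivity, inv_le_one_of_one_le₀ (by linarith)⟩
      · have : o + (1 + e)⁻¹ • (x - o) - (o + (1 + e)⁻¹ • (m - o)) = (1 + e)⁻¹ • (x - m) := by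
          module
        rw [this, norm_smul, norm_inv, Real.norm_of_nonneg hpos.le, inv_mul_le_iff₀ hpos]
        linarith
    · rw [AffineMap.homothety_apply, vsub_eq_sub, vadd_eq_add, add_sub_cancel_left, smul_smul,
        mul_inv_cancel₀ hpos.ne', one_smul, sub_add_cancel]
  have hsub1 : pbody M 1 ⊆ pbody M (1 + e) := by
    intro x hx
    rw [aux_mem_pbody] at hx ⊢
    obtain ⟨m, hm, h⟩ := hx
    exact ⟨m, hm, by linarith⟩
  have hball : volume (pbody M 1) ≤ volume (closedBall (0 : En n) (r + 1)) := by
    rw [← Measure.addHaar_closedBall_center volume z]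
    apply measure_mono
    intro x hx
    rw [aux_mem_pbody] at hx
    obtain ⟨m, hm, h⟩ := hx
    have := hz hm
    rw [mem_closedBall] at this ⊢
    rw [← dist_eq_norm] at h
    linarith [dist_triangle x m z]
  have hballfin : volume (closedBall (0 : En n) (r + 1)) ≠ ⊤ := measure_closedBall_lt_top.ne
  rw [measure_diff hsub1 hb1.2.1.measurableSet.nullMeasurableSet hfin]
  have h2 := (measure_mono hsub).trans_eq (Measure.addHaar_image_homothety volume o (1 + e) _)
  rw [finrank_euclideanSpace_fin, abs_of_nonneg (by positivity)] at h2
  rw [tsub_le_iff_right]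
  refine h2.trans ?_
  rw [← ENNReal.ofReal_toReal hfin, ← ENNReal.ofReal_mul (by positivity),
    ← ENNReal.ofReal_add (by positivity) (by positivity)]
  apply ENNReal.ofReal_le_ofReal
  have h3 := ENNReal.toReal_mono hballfin hball
  have h4 := aux_pow n h0 h1
  set V := (volume (pbody M 1)).toReal
  have hV : 0 ≤ V := ENNReal.toReal_nonneg
  calc (1 + e) ^ n * V ≤ (1 + 2 ^ n * e) * V := by
        gcongr
        linarith
    _ = 2 ^ n * e * V + V := by ring
    _ ≤ _ := by gcongr

/-- Volume estimate for the symmetric difference of the shells: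
`vol_n(K^ρ △ L^ρ) ≤ C(R) d_H(K,L)` for `0 < ρ ≤ 1` and `d_H(K,L) ≤ 1`. -/
theorem volume_symmDiff_shell_le (n : ℕ) (hn : 1 ≤ n) (R : ℝ) (hR : 0 < R) :
    ∃ C : ℝ, 0 < C ∧
      ∀ K L : Set (En n), IsConvexBody K → IsConvexBody L →
        (∃ z : En n, K ⊆ Metric.closedBall z R ∧ L ⊆ Metric.closedBall z R) →
        Metric.hausdorffDist K L ≤ 1 →
        ∀ ρ : ℝ, 0 < ρ → ρ ≤ 1 →
          (volume (symmDiff (shell K ρ) (shell L ρ))).toReal ≤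
            C * Metric.hausdorffDist K L := by
  set V := (volume (closedBall (0 : En n) (R + 1 + 1))).toReal with hV
  have hV0 : 0 ≤ V := ENNReal.toReal_nonneg
  refine ⟨4 * (2 ^ n * V) + 1, by positivity, ?_⟩
  rintro K L hK hL ⟨z, hKz, hLz⟩ hd ρ hρ0 hρ1
  set e := Metric.hausdorffDist K L with he
  have he0 : 0 ≤ e := Metric.hausdorffDist_nonneg
  have half : ∀ A B : Set (En n), IsConvexBody A → IsConvexBody B → B ⊆ closedBall z R →
      Metric.hausdorffDist A B = e →
      volume (A \ B) ≤ ENNReal.ofReal (2 ^ n * e * V) ∧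
      volume (pbody A ρ \ pbody B ρ) ≤ ENNReal.ofReal (2 ^ n * e * V) := by
    intro A B hA hB hBz hAB
    have hfin := hausdorffEDist_ne_top_of_nonempty_of_bounded hA.1 hB.1
      hA.2.1.isBounded hB.2.1.isBounded
    have hnear : ∀ a ∈ A, ∃ b ∈ B, ‖a - b‖ ≤ e := by
      intro a ha
      obtain ⟨b, hb, hab⟩ := hB.2.1.exists_infDist_eq_dist hB.1 a
      refine ⟨b, hb, ?_⟩
      rw [← dist_eq_norm, ← hab, ← hAB]
      exact infDist_le_hausdorffDist_of_mem ha hfin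
    constructor
    · refine (measure_mono ?_).trans (aux_main_s7 hB he0 hd (z := z) (r := R + 1) ?_)
      · rintro x ⟨hx, hx'⟩
        exact ⟨aux_mem_pbody.2 (hnear x hx), hx'⟩
      · exact hBz.trans (closedBall_subset_closedBall (by linarith))
    · refine (measure_mono ?_).trans (aux_main_s7 (aux_body hB hρ0.le) he0 hd (z := z) (r := R + 1) ?_)
      · rintro x ⟨hx, hx'⟩
        refine ⟨aux_mem_pbody.2 ?_, hx'⟩
        obtain ⟨a, ha, hxa⟩ := aux_mem_pbody.1 hx
        obtain ⟨b, hb, hab⟩ := hnear a ha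
        refine ⟨x - a + b, aux_mem_pbody.2 ⟨b, hb, by simpa using hxa⟩, ?_⟩
        have : x - (x - a + b) = a - b := by abel
        rwa [this]
      · intro x hx
        obtain ⟨b, hb, hxb⟩ := aux_mem_pbody.1 hx
        have := hBz hb
        rw [mem_closedBall] at this ⊢
        rw [← dist_eq_norm] at hxb
        linarith [dist_triangle x b z]
  obtain ⟨h1, h2⟩ := half K L hK hL hLz rfl
  obtain ⟨h3, h4⟩ := half L K hL hK hKz hausdorffDist_comm
  have hsub : symmDiff (shell K ρ) (shell L ρ) ⊆
      ((K \ L) ∪ (pbody K ρ \ pbody L ρ)) ∪ ((L \ K) ∪ (pbody L ρ \ pbody K ρ)) := by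
    intro x hx
    simp only [Set.mem_symmDiff, shell, Set.mem_diff, Set.mem_union] at hx ⊢
    tauto
  have hx0 : 0 ≤ 2 ^ n * e * V := by positivity
  have hle : volume (symmDiff (shell K ρ) (shell L ρ)) ≤ ENNReal.ofReal (4 * (2 ^ n * e * V)) := by
    refine (measure_mono hsub).trans ((measure_union_le _ _).trans
      ((add_le_add ((measure_union_le _ _).trans (add_le_add h1 h2))
        ((measure_union_le _ _).trans (add_le_add h3 h4))).trans_eq ?_))
    rw [← ENNReal.ofReal_add hx0 hx0, ← ENNReal.ofReal_add (by positivity) (by positivity)]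
    congr 1
    ring
  refine (ENNReal.toReal_le_of_le_ofReal (by positivity) hle).trans ?_
  nlinarith


end
end

section
/- Let n ≥ 1 and R > 0. There exists a constant C' > 0, depending only on n and R, such that for all convex bodies K, L in ℝⁿ with K + 2Bⁿ and L + 2Bⁿ contained in a closed ball of radius R, one has d_bL(S_{n−1}(K,·), S_{n−1}(L,·)) ≤ C' · d_H(K, L)^{1/2}, where the bounded Lipschitz distance is taken over functions g : S^{n−1} → ℝ with Lipschitz constant ≤ 1 (with respect to the Euclidean metric) and sup|g| ≤ 1. -/
open MeasureTheory Metric Set Real Pointwise RealInnerProductSpace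

noncomputable section

namespace AMH

variable {n : ℕ}

lemma proj_inner {K : Set (En n)} (hK : IsConvexBody K) {p : En n → En n}
    (hp : IsMetricProj K p) (x w : En n) (hw : w ∈ K) :
    inner ℝ (x - p x) (w - p x) ≤ 0 := by
  refine (norm_eq_iInf_iff_real_inner_le_zero hK.2.2 (hp x).1).1 ?_ w hw
  rw [← dist_eq_norm, (hp x).2, Metric.infDist_eq_iInf]
  simp only [dist_eq_norm]

lemma exists_proj {K : Set (En n)} (hK : IsConvexBody K) : ∃ p, IsMetricProj K p := by
  have h : ∀ x, ∃ y ∈ K, Metric.infDist x K = dist x y := fun x =>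
    hK.2.1.exists_infDist_eq_dist hK.1 x
  choose p h1 h2 using h
  exact ⟨p, fun x => ⟨h1 x, (h2 x).symm⟩⟩

lemma proj_lip {K : Set (En n)} (hK : IsConvexBody K) {p : En n → En n}
    (hp : IsMetricProj K p) : LipschitzWith 1 p := by
  refine LipschitzWith.of_dist_le_mul fun x y => ?_
  have h1 := proj_inner hK hp x (p y) (hp y).1
  have h2 := proj_inner hK hp y (p x) (hp x).1
  rw [dist_eq_norm, dist_eq_norm]
  have h3 : ‖p x - p y‖ ^ 2 ≤ inner ℝ (x - y) (p x - p y) := by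
    rw [← real_inner_self_eq_norm_sq]
    have : inner ℝ (x - y) (p x - p y) - inner ℝ (p x - p y) (p x - p y)
        = - inner ℝ (x - p x) (p y - p x) - inner ℝ (y - p y) (p x - p y) := by
      simp only [inner_sub_left, inner_sub_right, real_inner_comm]
      ring
    linarith
  have h4 := real_inner_le_norm (x - y) (p x - p y)
  simp only [NNReal.coe_one, one_mul]
  by_contra! hlt
  have : 0 < ‖p x - p y‖ := lt_of_le_of_lt (norm_nonneg _) hlt
  nlinarith

lemma pbody_eq {K : Set (En n)} (hK : IsConvexBody K) {ρ : ℝ} (hρ : 0 ≤ ρ) :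
    pbody K ρ = {x | Metric.infDist x K ≤ ρ} := by
  unfold pbody
  rw [hK.2.1.add_closedBall_zero hρ]
  ext x
  rw [Metric.cthickening_eq_preimage_infEDist]
  simp only [mem_preimage, mem_Iic, mem_ofPred_eq, Metric.infDist]
  rw [ENNReal.le_ofReal_iff_toReal_le (Metric.infEDist_ne_top hK.1) hρ]

lemma pbody_body {K : Set (En n)} (hK : IsConvexBody K) {ρ : ℝ} (hρ : 0 ≤ ρ) :
    IsConvexBody (pbody K ρ) := by
  refine ⟨hK.1.add ⟨0, by simpa using hρ⟩, hK.2.1.add (isCompact_closedBall _ _),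
    hK.2.2.add (convex_closedBall _ _)⟩

lemma pbody_pbody {K : Set (En n)} {ρ σ : ℝ} (hρ : 0 ≤ ρ) (hσ : 0 ≤ σ) :
    pbody (pbody K ρ) σ = pbody K (ρ + σ) := by
  unfold pbody
  rw [add_assoc, closedBall_add_closedBall hρ hσ, add_zero]

lemma pbody_mono {K : Set (En n)} {ρ σ : ℝ} (h : ρ ≤ σ) : pbody K ρ ⊆ pbody K σ :=
  add_subset_add_left (closedBall_subset_closedBall h)

lemma meas_shell {K : Set (En n)} (hK : IsConvexBody K) {ρ : ℝ} (hρ : 0 ≤ ρ) :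
    MeasurableSet (shell K ρ) :=
  (pbody_body hK hρ).2.1.measurableSet.diff hK.2.1.measurableSet

lemma infDist_pos {K : Set (En n)} (hK : IsConvexBody K) {x : En n} (hx : x ∉ K) :
    0 < Metric.infDist x K :=
  (hK.2.1.isClosed.notMem_iff_infDist_pos hK.1).1 hx

lemma uvec_norm {K : Set (En n)} (hK : IsConvexBody K) {p : En n → En n}
    (hp : IsMetricProj K p) {x : En n} (hx : x ∉ K) : ‖uvec K p x‖ = 1 := by
  have h := infDist_pos hK hx
  unfold uvec
  rw [norm_smul, ← dist_eq_norm, (hp x).2, norm_inv, Real.norm_of_nonneg h.le]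
  field_simp

lemma uvec_smul {K : Set (En n)} (hK : IsConvexBody K) {p : En n → En n}
    {x : En n} (hx : x ∉ K) : x - p x = Metric.infDist x K • uvec K p x := by
  have h := infDist_pos hK hx
  unfold uvec
  rw [smul_smul, mul_inv_cancel₀ h.ne', one_smul]

lemma uvec_inner {K : Set (En n)} (hK : IsConvexBody K) {p : En n → En n}
    (hp : IsMetricProj K p) {x : En n} (hx : x ∉ K) {w : En n} (hw : w ∈ K) :
    inner ℝ (uvec K p x) (w - p x) ≤ 0 := by
  have h := infDist_pos hK hx
  unfold uvec
  rw [real_inner_smul_left]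
  exact mul_nonpos_of_nonneg_of_nonpos (inv_nonneg.2 h.le) (proj_inner hK hp x w hw)

lemma uvec_cont {K : Set (En n)} (hK : IsConvexBody K) {p : En n → En n}
    (hp : IsMetricProj K p) : ContinuousOn (uvec K p) Kᶜ := by
  unfold uvec
  refine ContinuousOn.smul (ContinuousOn.inv₀ (Metric.continuous_infDist_pt K).continuousOn
    fun x hx => (infDist_pos hK hx).ne') ?_
  exact (continuous_id.sub (proj_lip hK hp).continuous).continuousOn

/-- expanding -/
lemma expand {K : Set (En n)} (hK : IsConvexBody K) {p : En n → En n}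
    (hp : IsMetricProj K p) {x y : En n} (hx : x ∉ K) (hy : y ∉ K) :
    ‖x - y‖ ≤ ‖(x + uvec K p x) - (y + uvec K p y)‖ := by
  set u := uvec K p x with hu
  set v := uvec K p y with hv
  have hx0 := infDist_pos hK hx
  have hy0 := infDist_pos hK hy
  have e1 : x = p x + Metric.infDist x K • u := by rw [← uvec_smul hK hx]; abel
  have e2 : y = p y + Metric.infDist y K • v := by rw [← uvec_smul hK hy]; abel
  have i1 := uvec_inner hK hp hx (hp y).1
  have i2 := uvec_inner hK hp hy (hp x).1
  rw [← hu] at i1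
  rw [← hv] at i2
  have n1 : ‖u‖ = 1 := uvec_norm hK hp hx
  have n2 : ‖v‖ = 1 := uvec_norm hK hp hy
  have i3 : inner ℝ u v ≤ 1 := by
    have := real_inner_le_norm u v
    rwa [n1, n2, one_mul] at this
  have key : 0 ≤ inner ℝ (x - y) (u - v) := by
    have hs1 : inner ℝ u u = (1:ℝ) := by rw [real_inner_self_eq_norm_sq, n1]; norm_num
    have hs2 : inner ℝ v v = (1:ℝ) := by rw [real_inner_self_eq_norm_sq, n2]; norm_num
    have : inner ℝ (x - y) (u - v) = - inner ℝ u (p y - p x) - inner ℝ v (p x - p y)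
        + (Metric.infDist x K + Metric.infDist y K) * (1 - inner ℝ u v) := by
      generalize Metric.infDist x K = a at *
      generalize Metric.infDist y K = b at *
      generalize p x = px at *
      generalize p y = py at *
      clear_value u v
      subst e1 e2
      simp only [inner_sub_left, inner_sub_right, inner_add_left, real_inner_smul_left, hs1, hs2]
      rw [real_inner_comm v u, real_inner_comm px u, real_inner_comm px v, real_inner_comm py u,
        real_inner_comm py v]
      ring
    rw [this]
    have : 0 ≤ (Metric.infDist x K + Metric.infDist y K) * (1 - inner ℝ u v) :=
      mul_nonneg (by linarith) (by linarith)
    linarith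
  have e3 : (x + u) - (y + v) = (x - y) + (u - v) := by abel
  rw [e3]
  refine le_of_sq_le_sq ?_ (norm_nonneg _)
  rw [norm_add_sq_real]
  nlinarith [sq_nonneg ‖u - v‖]

lemma vol_lip {s : Set (En n)} {f : En n → En n} (h : LipschitzOnWith 1 f s) :
    volume (f '' s) ≤ volume s := by
  have hfin : (Module.finrank ℝ (En n) : ℝ) = n := by simp
  have e := Measure.isAddLeftInvariant_eq_smul (volume : Measure (En n))
    (Measure.hausdorffMeasure (Module.finrank ℝ (En n) : ℝ))
  rw [e]
  simp only [Measure.smul_apply]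
  have := h.hausdorffMeasure_image_le (d := (Module.finrank ℝ (En n) : ℝ)) (by positivity)
  simp only [ENNReal.coe_one, ENNReal.one_rpow, one_mul] at this
  gcongr

lemma vol_step {K : Set (En n)} (hK : IsConvexBody K) {s : ℝ} (hs : 0 ≤ s) :
    volume (shell K s) ≤ volume (shell (pbody K 1) s) := by
  obtain ⟨p, hp⟩ := exists_proj hK
  set φ : En n → En n := fun x => x + uvec K p x with hφ
  have hinj : InjOn φ (shell K s) := by
    intro x hx y hy hxy
    have := expand hK hp hx.2 hy.2
    simp only [hφ] at hxy
    rw [hxy, sub_self, norm_zero] at this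
    exact sub_eq_zero.1 (norm_le_zero_iff.1 this)
  have hlip : LipschitzOnWith 1 (Function.invFunOn φ (shell K s)) (φ '' shell K s) := by
    refine LipschitzOnWith.of_dist_le_mul ?_
    rintro _ ⟨x, hx, rfl⟩ _ ⟨y, hy, rfl⟩
    rw [hinj.leftInvOn_invFunOn hx, hinj.leftInvOn_invFunOn hy, dist_eq_norm, dist_eq_norm]
    simpa [hφ] using expand hK hp hx.2 hy.2
  have h1 := vol_lip hlip
  rw [hinj.leftInvOn_invFunOn.image_image] at h1
  refine h1.trans (measure_mono ?_)
  rintro _ ⟨x, hx, rfl⟩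
  have hd := infDist_pos hK hx.2
  have hn1 := uvec_norm hK hp hx.2
  have e1 : x = p x + Metric.infDist x K • uvec K p x := by rw [← uvec_smul hK hx.2]; abel
  refine ⟨?_, ?_⟩
  · refine ⟨p x + uvec K p x, ⟨p x, (hp x).1, uvec K p x, by simp [hn1], rfl⟩,
      x - p x, ?_, ?_⟩
    · rw [mem_closedBall_zero_iff, ← dist_eq_norm, (hp x).2]
      have := hx.1
      rw [pbody_eq hK hs] at this
      exact this
    · simp only [hφ]; abel
  · rintro ⟨k, hk, b, hb, hkb⟩
    have hb' : ‖b‖ ≤ 1 := by simpa using hb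
    have i1 := uvec_inner hK hp hx.2 hk
    have i2 := real_inner_le_norm (uvec K p x) b
    rw [hn1, one_mul] at i2
    have e2 : b = p x - k + (Metric.infDist x K + 1) • uvec K p x := by
      have h3 : b = φ x - k := by rw [← hkb]; simp
      rw [h3, add_smul, one_smul]
      simp only [hφ]
      nth_rewrite 1 [e1]
      abel
    have i3 : inner ℝ (uvec K p x) b = - inner ℝ (uvec K p x) (k - p x)
        + (Metric.infDist x K + 1) := by
      rw [e2, inner_add_right, real_inner_smul_right, real_inner_self_eq_norm_sq, hn1,
        ← inner_neg_right, neg_sub]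
      ring
    linarith

lemma pow_bd (n : ℕ) {s : ℝ} (hs : 0 ≤ s) (hs1 : s ≤ 1) : (1 + s) ^ n ≤ 1 + s * (2 ^ n - 1) := by
  induction n with
  | zero => simp
  | succ k ih =>
    have h2 : (1:ℝ) ≤ 2 ^ k := one_le_pow₀ (by norm_num)
    have h3 : s * s * (2 ^ k - 1) ≤ s * (2 ^ k - 1) := by
      have := mul_le_mul_of_nonneg_left hs1 hs
      nlinarith [mul_nonneg hs (sub_nonneg.2 h2)]
    rw [pow_succ, pow_succ]
    nlinarith [mul_le_mul_of_nonneg_right ih (by linarith : 0 ≤ 1 + s)]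

lemma vol_shell_pbody {K : Set (En n)} (hK : IsConvexBody K) {s : ℝ} (hs : 0 ≤ s) (hs1 : s ≤ 1) :
    volume (shell (pbody K 1) s) ≤ ENNReal.ofReal (s * 2 ^ n) * volume (pbody K 1) := by
  have hB := pbody_body hK zero_le_one
  obtain ⟨z, hz⟩ := hK.1
  have hfin : volume (pbody K 1) ≠ ⊤ := hB.2.1.measure_ne_top
  have hsub : pbody (pbody K 1) s ⊆ AffineMap.homothety z (1 + s) '' pbody K 1 := by
    rintro _ ⟨k, hk, b, hb, rfl⟩
    have hb' : ‖b‖ ≤ s := by simpa using hb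
    have hmem : ∃ c, c ∈ pbody K 1 ∧ b = s • (c - z) := by
      rcases hs.eq_or_lt with h0 | h0
      · refine ⟨k, hk, ?_⟩
        rw [← h0] at hb' ⊢
        simpa using hb'
      · refine ⟨z + s⁻¹ • b, ⟨z, hz, s⁻¹ • b, ?_, rfl⟩, ?_⟩
        · rw [mem_closedBall_zero_iff, norm_smul, norm_inv, Real.norm_of_nonneg hs]
          rw [inv_mul_le_iff₀ h0]; linarith
        · rw [add_sub_cancel_left, smul_smul, mul_inv_cancel₀ h0.ne', one_smul]
    obtain ⟨c, hc, rfl⟩ := hmem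
    have h1s : (0:ℝ) < 1 + s := by linarith
    refine ⟨(1 / (1 + s)) • k + (s / (1 + s)) • c, hB.2.2 hk hc (by positivity) (by positivity)
      (by field_simp), ?_⟩
    rw [AffineMap.homothety_apply, vsub_eq_sub, vadd_eq_add, smul_sub, smul_add, smul_smul,
      smul_smul]
    rw [mul_div_cancel₀ _ h1s.ne', mul_div_cancel₀ _ h1s.ne', one_smul, add_smul, smul_sub,
      one_smul]
    abel
  have hss : pbody K 1 ⊆ pbody (pbody K 1) s := by
    intro x hx
    exact ⟨x, hx, 0, by simpa using hs, by simp⟩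
  unfold shell
  rw [measure_sdiff hss hB.2.1.measurableSet.nullMeasurableSet hfin]
  rw [tsub_le_iff_right]
  refine (measure_mono hsub).trans ?_
  rw [Measure.addHaar_image_homothety]
  have : |(1 + s) ^ Module.finrank ℝ (En n)| = (1 + s) ^ n := by
    rw [abs_of_nonneg (by positivity)]; simp
  rw [this]
  have h1 : ENNReal.ofReal ((1 + s) ^ n) ≤ ENNReal.ofReal (s * 2 ^ n) + 1 := by
    rw [← ENNReal.ofReal_one, ← ENNReal.ofReal_add (by positivity) (by norm_num)]
    apply ENNReal.ofReal_le_ofReal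
    have := pow_bd n hs hs1
    linarith
  calc _ ≤ (ENNReal.ofReal (s * 2 ^ n) + 1) * volume (pbody K 1) := by gcongr
    _ = _ := by rw [add_mul, one_mul]

lemma vol_shell {K : Set (En n)} (hK : IsConvexBody K) {z : En n} {R s : ℝ}
    (hKR : pbody K 1 ⊆ Metric.closedBall z R) (hs : 0 ≤ s) (hs1 : s ≤ 1) :
    volume (shell K s) ≤
      ENNReal.ofReal (s * (2 ^ n * (volume (Metric.closedBall (0 : En n) R)).toReal)) := by
  refine (vol_step hK hs).trans ((vol_shell_pbody hK hs hs1).trans ?_)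
  rw [← mul_assoc, ENNReal.ofReal_mul (p := s * 2 ^ n) (by positivity), ENNReal.ofReal_toReal
    (isCompact_closedBall _ _).measure_ne_top]
  refine mul_le_mul_right ?_ _
  rw [← Measure.addHaar_closedBall_center volume z R]
  exact measure_mono hKR

/-- projection comparison -/
lemma proj_cmp {K L : Set (En n)} (hK : IsConvexBody K) (hL : IsConvexBody L)
    {p q : En n → En n} (hp : IsMetricProj K p) (hq : IsMetricProj L q) {δ : ℝ}
    (h1 : ∀ x ∈ K, Metric.infDist x L ≤ δ) (h2 : ∀ x ∈ L, Metric.infDist x K ≤ δ) (x : En n) :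
    ‖p x - q x‖ ^ 2 ≤ δ * (Metric.infDist x K + Metric.infDist x L) := by
  have i1 := proj_inner hK hp x _ (hp (q x)).1
  have i2 := proj_inner hL hq x _ (hq (p x)).1
  have d1 : ‖q x - p (q x)‖ ≤ δ := by
    rw [← dist_eq_norm, (hp _).2]; exact h2 _ (hq x).1
  have d2 : ‖p x - q (p x)‖ ≤ δ := by
    rw [← dist_eq_norm, (hq _).2]; exact h1 _ (hp x).1
  have j1 := real_inner_le_norm (x - p x) (q x - p (q x))
  have j2 := real_inner_le_norm (x - q x) (p x - q (p x))
  have a1 : ‖x - p x‖ = Metric.infDist x K := by rw [← dist_eq_norm, (hp _).2]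
  have a2 : ‖x - q x‖ = Metric.infDist x L := by rw [← dist_eq_norm, (hq _).2]
  rw [a1] at j1
  rw [a2] at j2
  have b1 := mul_le_mul_of_nonneg_left d1 (Metric.infDist_nonneg (x := x) (s := K))
  have b2 := mul_le_mul_of_nonneg_left d2 (Metric.infDist_nonneg (x := x) (s := L))
  have : ‖p x - q x‖ ^ 2 = inner ℝ (x - p x) (p (q x) - p x) + inner ℝ (x - p x) (q x - p (q x))
      + (inner ℝ (x - q x) (q (p x) - q x) + inner ℝ (x - q x) (p x - q (p x))) := by
    rw [← inner_add_right, ← inner_add_right, ← real_inner_self_eq_norm_sq]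
    rw [show p (q x) - p x + (q x - p (q x)) = -(p x - q x) by abel,
      show q (p x) - q x + (p x - q (p x)) = p x - q x by abel, inner_neg_right,
      neg_add_eq_sub, ← inner_sub_left]
    congr 1
    abel
  linarith

lemma uvec_cmp {K L : Set (En n)} (hK : IsConvexBody K) (hL : IsConvexBody L)
    {p q : En n → En n} (hp : IsMetricProj K p) (hq : IsMetricProj L q) {δ : ℝ} (hδ : 0 ≤ δ)
    (h1 : ∀ x ∈ K, Metric.infDist x L ≤ δ) (h2 : ∀ x ∈ L, Metric.infDist x K ≤ δ)
    {x : En n} (hab : |Metric.infDist x K - Metric.infDist x L| ≤ δ)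
    (hx : x ∉ K) (hx' : x ∉ L) {t : ℝ} (ht : 0 < t) (htK : t ^ 2 ≤ Metric.infDist x K) :
    ‖uvec K p x - uvec L q x‖ ≤ 3 * √δ / t := by
  have nu := uvec_norm hK hp hx
  have nv := uvec_norm hL hq hx'
  have ha := infDist_pos hK hx
  have hb := infDist_pos hL hx'
  have hpq := proj_cmp hK hL hp hq h1 h2 x
  have ea := uvec_smul (p := p) hK hx
  have eb := uvec_smul (p := q) hL hx'
  set a := Metric.infDist x K
  set b := Metric.infDist x L
  set u := uvec K p x
  set v := uvec L q x
  set r := √δ with hr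
  have hr0 : 0 ≤ r := Real.sqrt_nonneg _
  have hrr : r ^ 2 = δ := Real.sq_sqrt hδ
  rw [le_div_iff₀ ht]
  have hab' := abs_le.1 hab
  have htw : ‖u - v‖ ≤ 2 := by
    have := norm_sub_le u v
    linarith
  by_cases hrt : t ≤ r
  · nlinarith [norm_nonneg (u - v)]
  · push Not at hrt
    set s := √a with hs
    have hs0 : 0 < s := Real.sqrt_pos.2 ha
    have hss : s ^ 2 = a := Real.sq_sqrt ha.le
    have hts : t ≤ s := Real.le_sqrt_of_sq_le htK
    have hpq2 : ‖p x - q x‖ ≤ 2 * (r * s) := by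
      refine le_of_sq_le_sq ?_ (by positivity)
      have : δ ≤ a := by rw [← hrr, ← hss]; gcongr; linarith
      calc _ ≤ δ * (a + b) := hpq
        _ ≤ δ * (4 * a) := by gcongr; linarith
        _ = _ := by rw [← hrr, ← hss]; ring
    have e : a • (u - v) = (q x - p x) + (b - a) • v := by
      rw [smul_sub, sub_smul, ← ea, ← eb]; abel
    have h3 : a * ‖u - v‖ ≤ 2 * (r * s) + δ := by
      have h4 : ‖a • (u - v)‖ = a * ‖u - v‖ := by rw [norm_smul, Real.norm_of_nonneg ha.le]
      rw [← h4, e]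
      refine (norm_add_le _ _).trans ?_
      rw [norm_sub_rev, norm_smul, nv, mul_one, Real.norm_eq_abs, abs_sub_comm]
      linarith
    have h5 : s * (s * ‖u - v‖) ≤ s * (3 * r) := by
      have : δ ≤ r * s := by rw [← hrr, sq]; gcongr; linarith
      calc _ = a * ‖u - v‖ := by rw [← hss]; ring
        _ ≤ _ := by linarith
    have h6 := le_of_mul_le_mul_left h5 hs0
    nlinarith [norm_nonneg (u - v)]

lemma g_integrable {K : Set (En n)} (hK : IsConvexBody K) {p : En n → En n}
    (hp : IsMetricProj K p) {g : En n → ℝ} (hg : IsSphereBLFun g) {ρ : ℝ} (hρ : 0 ≤ ρ) :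
    IntegrableOn (fun x => g (uvec K p x)) (shell K ρ) := by
  have hgc : ContinuousOn g {a | ‖a‖ = 1} := by
    have : LipschitzOnWith 1 g {a | ‖a‖ = 1} := by
      refine LipschitzOnWith.of_dist_le_mul fun a ha b hb => ?_
      rw [Real.dist_eq, dist_eq_norm, NNReal.coe_one, one_mul]
      exact hg.1 a b ha hb
    exact this.continuousOn
  have hc : ContinuousOn (fun x => g (uvec K p x)) (shell K ρ) :=
    hgc.comp ((uvec_cont hK hp).mono fun x hx => hx.2) fun x hx => uvec_norm hK hp hx.2
  refine IntegrableOn.of_bound ?_ (hc.aestronglyMeasurable (meas_shell hK hρ)) 1 ?_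
  · exact (measure_mono sdiff_subset).trans_lt (pbody_body hK hρ).2.1.measure_lt_top
  · refine (ae_restrict_iff' (meas_shell hK hρ)).2 (Filter.Eventually.of_forall fun x hx => ?_)
    exact hg.2 _ (uvec_norm hK hp hx.2)

lemma main_bd {K L : Set (En n)} (hK : IsConvexBody K) (hL : IsConvexBody L)
    {p q : En n → En n} (hp : IsMetricProj K p) (hq : IsMetricProj L q)
    {z : En n} {R : ℝ} (hKR : pbody K 2 ⊆ Metric.closedBall z R)
    (hLR : pbody L 2 ⊆ Metric.closedBall z R) {g : En n → ℝ} (hg : IsSphereBLFun g)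
    {ρ : ℝ} (hρ : 0 ≤ ρ) (hρ1 : ρ ≤ 1) :
    |(∫ x in shell K ρ, g (uvec K p x)) - ∫ x in shell L ρ, g (uvec L q x)| ≤
      16 * (2 ^ n * (volume (Metric.closedBall (0 : En n) R)).toReal) *
        √(Metric.hausdorffDist K L) := by
  set V := (volume (Metric.closedBall (0 : En n) R)).toReal with hV
  have hV0 : 0 ≤ V := ENNReal.toReal_nonneg
  set A := 2 ^ n * V with hA
  have hA0 : 0 ≤ A := by positivity
  have hVA : V ≤ A := by
    have h2 : (1:ℝ) ≤ 2 ^ n := one_le_pow₀ (by norm_num)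
    nlinarith
  set δ := Metric.hausdorffDist K L with hδ
  have hδ0 : 0 ≤ δ := Metric.hausdorffDist_nonneg
  rcases lt_or_ge 1 δ with hδ1 | hδ1
  · have hbd : ∀ {M : Set (En n)} (_ : IsConvexBody M) {r : En n → En n} (_ : IsMetricProj M r)
        (_ : pbody M 2 ⊆ Metric.closedBall z R), |∫ x in shell M ρ, g (uvec M r x)| ≤ V := by
      intro M hM r hr hMR
      have hsub : shell M ρ ⊆ Metric.closedBall z R :=
        sdiff_subset.trans ((pbody_mono (by linarith)).trans hMR)
      have hfin : volume (Metric.closedBall z R) < ⊤ := (isCompact_closedBall _ _).measure_lt_top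
      have := norm_setIntegral_le_of_norm_le_const (μ := volume) (C := 1)
        (f := fun x => g (uvec M r x))
        ((measure_mono hsub).trans_lt hfin) (fun x hx => hg.2 _ (uvec_norm hM hr hx.2))
      rw [one_mul, Real.norm_eq_abs] at this
      refine this.trans ?_
      rw [hV, ← Measure.addHaar_closedBall_center volume z R]
      exact ENNReal.toReal_mono hfin.ne (measure_mono hsub)
    have b1 := hbd hK hp hKR
    have b2 := hbd hL hq hLR
    have b3 := abs_sub (∫ x in shell K ρ, g (uvec K p x)) (∫ x in shell L ρ, g (uvec L q x))
    have : 1 ≤ √δ := Real.one_le_sqrt.2 hδ1.le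
    nlinarith
  have hfinKL : Metric.hausdorffEDist K L ≠ ⊤ :=
    Metric.hausdorffEDist_ne_top_of_nonempty_of_bounded hK.1 hL.1 hK.2.1.isBounded
      hL.2.1.isBounded
  have hfinLK : Metric.hausdorffEDist L K ≠ ⊤ := by rwa [Metric.hausdorffEDist_comm]
  have h1 : ∀ x ∈ K, Metric.infDist x L ≤ δ := fun x hx =>
    Metric.infDist_le_hausdorffDist_of_mem hx hfinKL
  have h2 : ∀ x ∈ L, Metric.infDist x K ≤ δ := fun x hx => by
    rw [hδ, Metric.hausdorffDist_comm]
    exact Metric.infDist_le_hausdorffDist_of_mem hx hfinLK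
  have hKL : ∀ x, Metric.infDist x L ≤ Metric.infDist x K + δ := fun x =>
    Metric.infDist_le_infDist_add_hausdorffDist hfinKL
  have hLK : ∀ x, Metric.infDist x K ≤ Metric.infDist x L + δ := fun x => by
    rw [hδ, Metric.hausdorffDist_comm]
    exact Metric.infDist_le_infDist_add_hausdorffDist hfinLK
  set T := (shell K δ ∪ shell L δ) ∪ (shell (pbody K ρ) δ ∪ shell (pbody L ρ) δ) with hT
  have hpK := pbody_body hK hρ
  have hpL := pbody_body hL hρ
  have hTm : MeasurableSet T :=
    ((meas_shell hK hδ0).union (meas_shell hL hδ0)).union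
      ((meas_shell hpK hδ0).union (meas_shell hpL hδ0))
  have hTv : volume T ≤ ENNReal.ofReal (4 * A * δ) := by
    have v1 := vol_shell hK ((pbody_mono (by norm_num)).trans hKR) hδ0 hδ1
    have v2 := vol_shell hL ((pbody_mono (by norm_num)).trans hLR) hδ0 hδ1
    have v3 := vol_shell hpK (by
      rw [pbody_pbody hρ zero_le_one]
      exact (pbody_mono (by linarith)).trans hKR) hδ0 hδ1
    have v4 := vol_shell hpL (by
      rw [pbody_pbody hρ zero_le_one]
      exact (pbody_mono (by linarith)).trans hLR) hδ0 hδ1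
    have hh : 0 ≤ δ * A := by positivity
    calc volume T ≤ (volume (shell K δ) + volume (shell L δ)) +
          (volume (shell (pbody K ρ) δ) + volume (shell (pbody L ρ) δ)) :=
        (measure_union_le _ _).trans (add_le_add (measure_union_le _ _) (measure_union_le _ _))
      _ ≤ (ENNReal.ofReal (δ * A) + ENNReal.ofReal (δ * A)) +
          (ENNReal.ofReal (δ * A) + ENNReal.ofReal (δ * A)) := by gcongr
      _ = ENNReal.ofReal (4 * A * δ) := by
        rw [← ENNReal.ofReal_add hh hh, ← ENNReal.ofReal_add (by positivity) (by positivity)]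
        congr 1; ring
  -- indicator formulation
  have mK := meas_shell hK hρ
  have mL := meas_shell hL hρ
  have iK := g_integrable hK hp hg hρ
  have iL := g_integrable hL hq hg hρ
  rw [← integral_indicator mK, ← integral_indicator mL,
    ← integral_sub (iK.integrable_indicator mK) (iL.integrable_indicator mL)]
  set F := (shell K ρ).indicator fun x => g (uvec K p x) with hF
  set G := (shell L ρ).indicator fun x => g (uvec L q x) with hG
  have hpt : ∀ x, ‖F x - G x‖ₑ ≤
      (∑' k : ℕ, (shell K ((1/4 : ℝ) ^ k)).indicator
        (fun _ => ENNReal.ofReal (3 * √δ * 2 ^ (k + 1))) x) + T.indicator (fun _ => 1) x := by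
    intro x
    have hone : ∀ r : ℝ, |r| ≤ 1 → ‖r‖ₑ ≤ 1 := by
      intro r hr
      rw [Real.enorm_eq_ofReal_abs]
      exact ENNReal.ofReal_le_one.2 hr
    by_cases hxK : x ∈ shell K ρ
    · have hdK : Metric.infDist x K ≤ ρ := by
        have := hxK.1
        rwa [pbody_eq hK hρ] at this
      by_cases hxL : x ∈ shell L ρ
      · refine le_trans ?_ le_self_add
        have ha := infDist_pos hK hxK.2
        obtain ⟨k, hk1, hk2⟩ := exists_nat_pow_near_of_lt_one ha (hdK.trans hρ1)
          (by norm_num : (0:ℝ) < 1/4) (by norm_num)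
        refine le_trans ?_ (ENNReal.le_tsum k)
        have hxk : x ∈ shell K ((1/4 : ℝ) ^ k) := by
          refine ⟨?_, hxK.2⟩
          rw [pbody_eq hK (by positivity)]
          exact hk2
        rw [indicator_of_mem hxk, hF, hG, indicator_of_mem hxK, indicator_of_mem hxL,
          Real.enorm_eq_ofReal_abs]
        apply ENNReal.ofReal_le_ofReal
        refine (hg.1 _ _ (uvec_norm hK hp hxK.2) (uvec_norm hL hq hxL.2)).trans ?_
        have := uvec_cmp hK hL hp hq hδ0 h1 h2 (x := x)
          (abs_le.2 ⟨by linarith [hKL x], by linarith [hLK x]⟩) hxK.2 hxL.2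
          (t := (1/2 : ℝ) ^ (k + 1)) (by positivity) (by
            rw [← pow_mul, mul_comm, pow_mul]
            norm_num at hk1 ⊢
            exact hk1.le)
        refine this.trans_eq ?_
        rw [one_div, inv_pow, div_inv_eq_mul]
      · refine le_trans ?_ le_add_self
        have hxT : x ∈ T := by
          by_cases hm : x ∈ L
          · refine Or.inl (Or.inl ⟨?_, hxK.2⟩)
            rw [pbody_eq hK hδ0]
            exact h2 x hm
          · refine Or.inr (Or.inr ⟨?_, fun hh => hxL ⟨hh, hm⟩⟩)
            rw [pbody_pbody hρ hδ0, pbody_eq hL (by positivity)]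
            exact (hKL x).trans (by linarith)
        rw [indicator_of_mem hxT, hF, hG, indicator_of_mem hxK, indicator_of_notMem hxL, sub_zero]
        exact hone _ (hg.2 _ (uvec_norm hK hp hxK.2))
    · by_cases hxL : x ∈ shell L ρ
      · have hdL : Metric.infDist x L ≤ ρ := by
          have := hxL.1
          rwa [pbody_eq hL hρ] at this
        refine le_trans ?_ le_add_self
        have hxT : x ∈ T := by
          by_cases hm : x ∈ K
          · refine Or.inl (Or.inr ⟨?_, hxL.2⟩)
            rw [pbody_eq hL hδ0]
            exact h1 x hm
          · refine Or.inr (Or.inl ⟨?_, fun hh => hxK ⟨hh, hm⟩⟩)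
            rw [pbody_pbody hρ hδ0, pbody_eq hK (by positivity)]
            exact (hLK x).trans (by linarith)
        rw [indicator_of_mem hxT, hF, hG, indicator_of_mem hxL, indicator_of_notMem hxK, zero_sub,
          enorm_neg]
        exact hone _ (hg.2 _ (uvec_norm hL hq hxL.2))
      · rw [hF, hG, indicator_of_notMem hxK, indicator_of_notMem hxL]
        simp
  have hm : ∀ k : ℕ, MeasurableSet (shell K ((1/4 : ℝ) ^ k)) := fun k =>
    meas_shell hK (by positivity)
  have htot : ‖∫ x, F x - G x‖ₑ ≤ ENNReal.ofReal (12 * A * √δ + 4 * A * δ) := by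
    refine (enorm_integral_le_lintegral_enorm _).trans ((lintegral_mono hpt).trans ?_)
    rw [lintegral_add_right _ (measurable_const.indicator hTm), lintegral_indicator hTm,
      lintegral_tsum fun k => (measurable_const.indicator (hm k)).aemeasurable,
      ENNReal.ofReal_add (by positivity) (by positivity)]
    refine add_le_add ?_ (by simpa using hTv)
    have hk : ∀ k : ℕ, ∫⁻ x, (shell K ((1/4 : ℝ) ^ k)).indicator
        (fun _ => ENNReal.ofReal (3 * √δ * 2 ^ (k + 1))) x ≤
        ENNReal.ofReal (6 * A * √δ * (1/2) ^ k) := by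
      intro k
      rw [lintegral_indicator (hm k), setLIntegral_const]
      have v1 := vol_shell hK ((pbody_mono (by norm_num)).trans hKR)
        (by positivity : (0:ℝ) ≤ (1/4) ^ k) (pow_le_one₀ (by norm_num) (by norm_num))
      refine (mul_le_mul_right v1 _).trans ?_
      rw [← ENNReal.ofReal_mul (by positivity)]
      apply le_of_eq
      congr 1
      have : (1/4 : ℝ) ^ k = (1/2) ^ k * (1/2) ^ k := by rw [← mul_pow]; norm_num
      rw [this]
      have h22 : (2:ℝ) ^ k * (1/2) ^ k = 1 := by rw [← mul_pow]; norm_num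
      rw [← hV, ← hA, pow_succ]
      linear_combination (6 * √δ * A * (1/2) ^ k) * h22
    refine (ENNReal.tsum_le_tsum hk).trans ?_
    rw [← ENNReal.ofReal_tsum_of_nonneg (fun k => by positivity)
      (summable_geometric_two.mul_left _), tsum_mul_left, tsum_geometric_two]
    apply le_of_eq
    congr 1; ring
  rw [Real.enorm_eq_ofReal_abs, ENNReal.ofReal_le_ofReal_iff (by positivity)] at htot
  refine htot.trans ?_
  have : δ ≤ √δ := Real.le_sqrt_of_sq_le (by nlinarith)
  nlinarith

end AMH

/-- Hölder continuity of the surface area measure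
`S_{n-1}(K,·) = 2·(π₂)_# Λ_{n-1}(K,·)` in the bounded Lipschitz metric on the sphere:
`d_bL(S_{n-1}(K,·), S_{n-1}(L,·)) ≤ C'(R) d_H(K,L)^{1/2}`. -/
theorem area_measure_holder (n : ℕ) (hn : 1 ≤ n) (R : ℝ) (hR : 0 < R) :
    ∃ C' : ℝ, 0 < C' ∧
      ∀ K L : Set (En n), IsConvexBody K → IsConvexBody L →
        (∃ z : En n, pbody K 2 ⊆ Metric.closedBall z R ∧ pbody L 2 ⊆ Metric.closedBall z R) →
        ∀ pK pL : En n → En n, IsMetricProj K pK → IsMetricProj L pL →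
          ∀ g : En n → ℝ, IsSphereBLFun g →
            |(2 * ∑ j : Fin n, steinerCoeff n ⟨n - 1, by omega⟩ j *
                ∫ x in shell K ((j.1 + 1 : ℝ) / n), g (uvec K pK x)) -
              (2 * ∑ j : Fin n, steinerCoeff n ⟨n - 1, by omega⟩ j *
                ∫ x in shell L ((j.1 + 1 : ℝ) / n), g (uvec L pL x))| ≤
              C' * Real.sqrt (Metric.hausdorffDist K L) := by
  set A := 16 * (2 ^ n * (volume (Metric.closedBall (0 : En n) R)).toReal) with hA
  have hA0 : 0 ≤ A := by positivity
  set S := ∑ j : Fin n, |steinerCoeff n ⟨n - 1, by omega⟩ j| with hS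
  have hS0 : 0 ≤ S := Finset.sum_nonneg fun j _ => abs_nonneg _
  refine ⟨2 * (S * A) + 1, by positivity, ?_⟩
  rintro K L hK hL ⟨z, hKR, hLR⟩ pK pL hp hq g hg
  have hd : 0 ≤ √(Metric.hausdorffDist K L) := Real.sqrt_nonneg _
  rw [← mul_sub, ← Finset.sum_sub_distrib, abs_mul, abs_of_pos (by norm_num : (0:ℝ) < 2)]
  have hn0 : (0:ℝ) < n := by exact_mod_cast hn
  have key : |∑ j : Fin n, (steinerCoeff n ⟨n - 1, by omega⟩ j *
      (∫ x in shell K ((j.1 + 1 : ℝ) / n), g (uvec K pK x)) -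
      steinerCoeff n ⟨n - 1, by omega⟩ j *
      ∫ x in shell L ((j.1 + 1 : ℝ) / n), g (uvec L pL x))| ≤
      S * (A * √(Metric.hausdorffDist K L)) := by
    refine (Finset.abs_sum_le_sum_abs _ _).trans ?_
    rw [hS, Finset.sum_mul]
    refine Finset.sum_le_sum fun j _ => ?_
    rw [← mul_sub, abs_mul]
    refine mul_le_mul_of_nonneg_left ?_ (abs_nonneg _)
    refine AMH.main_bd hK hL hp hq hKR hLR hg (by positivity) ?_
    rw [div_le_one hn0]
    exact_mod_cast j.2
  nlinarith

end
end
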